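/- Let X be a random variable with density f belonging to the integrated Pearson family IP(μ; δ, β, γ) with δ ≤ 0, let m, n be nonnegative integers with n ≥ 1, and let g ∈ H^{m,n}(X). Then S_{m,n}(g) = Var[g(X)] if and only if g coincides on the support (α, ω) of X with a polynomial of degree at most m+n. -/

import Mathlib

open MeasureTheory ProbabilityTheory Finset Filter

noncomputable section

/-- Falling factorial `(x)_k = x (x-1) ⋯ (x-k+1)`, with `(x)_0 = 1`. -/
def fall (x : ℝ) (k : ℕ) : ℝ := ∏ j ∈ Finset.range k, (x - j)

/-- Rising factorial `[x]_k = x (x+1) ⋯ (x+k-1)`, with `[x]_0 = 1`. -/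
def rise (x : ℝ) (k : ℕ) : ℝ := ∏ j ∈ Finset.range k, (x + j)

/-- The product `∏_{j=a}^{a+len-1} (1 - j δ)` of `len` consecutive factors
(an empty product is `1`). -/
def pp (δ a : ℝ) (len : ℕ) : ℝ := ∏ j ∈ Finset.range len, (1 - (a + j) * δ)

/-- The open real interval with (possibly infinite) endpoints `α ω : EReal`. -/
def erealIoo (α ω : EReal) : Set ℝ := {x : ℝ | α < (x : EReal) ∧ (x : EReal) < ω}

/-- `g` coincides on `J` with a polynomial of degree at most `d`. -/
def IsPolyOn (g : ℝ → ℝ) (J : Set ℝ) (d : ℕ) : Prop :=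
  ∃ p : Polynomial ℝ, p.natDegree ≤ d ∧ ∀ x ∈ J, g x = p.eval x

/-- The quadratic `q(x) = δ x² + β x + γ` of a Pearson family. -/
def pq (δ β γ : ℝ) : ℝ → ℝ := fun x => δ * x ^ 2 + β * x + γ

/-- `P` is the distribution of a random variable with density `f` (w.r.t. Lebesgue
measure) belonging to the integrated Pearson family `IP(μ; δ, β, γ)`:
`μ` is the (finite) mean of `P`, `|δ|+|β|+|γ| > 0`, and
`∫_{-∞}^x (μ - t) f(t) dt = q(x) f(x)` for all `x`. -/
def IsIntegratedPearson (P : Measure ℝ) (f : ℝ → ℝ) (μ δ β γ : ℝ) : Prop :=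
  IsProbabilityMeasure P ∧
  (∀ x, 0 ≤ f x) ∧
  P = volume.withDensity (fun x => ENNReal.ofReal (f x)) ∧
  Integrable (fun x : ℝ => x) P ∧
  μ = ∫ x, x ∂P ∧
  0 < |δ| + |β| + |γ| ∧
  ∀ x : ℝ, (∫ t in Set.Iic x, (μ - t) * f t) = pq δ β γ x * f x

/-- Membership in the class `H^{m,n}(X)` for the distribution `P` of `X` with Pearson
quadratic `q` and support `J`.  Here `gd k` plays the role of the `k`-th derivative
`g^{(k)}` of `g = gd 0` on `J`.  With `ℓ = max m n`:  `g ∈ C^{ℓ-1}(J)`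
(encoded by `gd k` having derivative `gd (k+1)` at every point of `J` for `k+1 < ℓ`,
and `gd (ℓ-1)` continuous on `J`), `g^{(ℓ-1)}` is absolutely continuous on `J` with
a.e. derivative `g^{(ℓ)} = gd ℓ` (encoded by the fundamental theorem of calculus:
`gd ℓ` is locally integrable and `gd (ℓ-1)` is its integral on every subinterval of `J`),
and the moment conditions `E[q(X)^n (g^{(n)}(X))²] < ∞` and
`E[q(X)^i |g^{(i)}(X)|] < ∞` for `n < i ≤ m` hold. -/
def MemH (P : Measure ℝ) (q : ℝ → ℝ) (J : Set ℝ) (m n : ℕ) (gd : ℕ → ℝ → ℝ) : Prop :=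
  (∀ k, k + 1 < max m n → ∀ x ∈ J, HasDerivAt (gd k) (gd (k + 1) x) x) ∧
  (1 ≤ max m n → ContinuousOn (gd (max m n - 1)) J) ∧
  (1 ≤ max m n → ∀ a ∈ J, ∀ b ∈ J,
    IntervalIntegrable (gd (max m n)) volume a b ∧
      gd (max m n - 1) b - gd (max m n - 1) a = ∫ t in a..b, gd (max m n) t) ∧
  Integrable (fun x => q x ^ n * (gd n x) ^ 2) P ∧
  ∀ i, n < i → i ≤ m → Integrable (fun x => q x ^ i * |gd i x|) P

/-- The variance bound `S_{m,n}(g)` of Theorem 2.1, for a Pearson distribution `P`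
with quadratic `q` and parameter `δ`. -/
def Sbound (P : Measure ℝ) (δ : ℝ) (q : ℝ → ℝ) (m n : ℕ) (gd : ℕ → ℝ → ℝ) : ℝ :=
  (∑ i ∈ Finset.Icc 1 m,
      ((m.choose i : ℝ) * pp δ ((m : ℝ) + i) n /
          (fall ((m : ℝ) + n) i * (∫ x, q x ^ i ∂P) * pp δ ((i : ℝ) - 1) i *
            pp δ (m : ℝ) n)) *
        (∫ x, q x ^ i * gd i x ∂P) ^ 2) +
    ∑ i ∈ Finset.Icc 1 n,
      (-1 : ℝ) ^ (i - 1) *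
          ((n.choose i : ℝ) / (fall ((m : ℝ) + n) i * pp δ (m : ℝ) i)) *
        ∫ x, q x ^ i * (gd i x) ^ 2 ∂P


/-- `h` is a weak derivative of `g` on `J`. -/
def WD (J : Set ℝ) (g h : ℝ → ℝ) : Prop :=
  ∀ a ∈ J, ∀ b ∈ J, IntervalIntegrable h volume a b ∧ g b - g a = ∫ t in a..b, h t

/-- Internal version of a (non-normalised) Pearson density. -/
structure Pr (δ β γ : ℝ) (J : Set ℝ) (f : ℝ → ℝ) (κ τ : ℝ) : Prop where
  hδ : δ ≤ 0
  hκ : 0 < κ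
  nonneg : ∀ x, 0 ≤ f x
  meas : Measurable f
  hJ : J = {x | 0 < f x}
  conn : J.OrdConnected
  isOpen : IsOpen J
  c_mem : τ / κ ∈ J
  int0 : Integrable f
  int1 : Integrable (fun x => x * f x)
  tot : ∫ t, (κ * t - τ) * f t = 0
  eq : ∀ x, ∫ t in Set.Iic x, (τ - κ * t) * f t = pq δ β γ x * f x
  qpos : ∀ x ∈ J, 0 < pq δ β γ x

theorem WD.contOn_uIcc {J : Set ℝ} {g h : ℝ → ℝ} (hW : WD J g h) (hc : J.OrdConnected)
    {a b : ℝ} (ha : a ∈ J) (hb : b ∈ J) : ContinuousOn g (Set.uIcc a b) := by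
  have h1 := (hW a ha b hb).1
  have h2 : ContinuousOn (fun x => g a + ∫ t in a..x, h t) (Set.uIcc a b) :=
    continuousOn_const.add
      (h1.absolutelyContinuousOnInterval_intervalIntegral (c := a) (by simp)).continuousOn
  refine h2.congr fun x hx => ?_
  have hx' : x ∈ J := hc.uIcc_subset ha hb hx
  have := (hW a ha x hx').2
  simp only [← this]; ring

theorem exists_Icc_nhds {J : Set ℝ} (hc : J.OrdConnected) (ho : IsOpen J) {x : ℝ} (hx : x ∈ J) :
    ∃ ε > 0, Set.Icc (x - ε) (x + ε) ⊆ J := by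
  obtain ⟨ε, hε, h⟩ := Metric.isOpen_iff.1 ho x hx
  refine ⟨ε / 2, by positivity, fun y hy => h ?_⟩
  rw [Metric.mem_ball, Real.dist_eq, abs_lt]
  constructor <;> linarith [hy.1, hy.2]

theorem WD.contOn {J : Set ℝ} {g h : ℝ → ℝ} (hW : WD J g h) (hc : J.OrdConnected)
    (ho : IsOpen J) : ContinuousOn g J := by
  intro x hx
  obtain ⟨ε, hε, hI⟩ := exists_Icc_nhds hc ho hx
  have h1 := hW.contOn_uIcc hc (hI ⟨le_refl _, by linarith⟩ : x - ε ∈ J)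
    (hI ⟨by linarith, le_refl _⟩ : x + ε ∈ J)
  rw [Set.uIcc_of_le (by linarith)] at h1
  exact (h1.continuousAt (Icc_mem_nhds (by linarith) (by linarith))).continuousWithinAt

theorem WD.aesm {J : Set ℝ} {g h : ℝ → ℝ} (hW : WD J g h) (hc : J.OrdConnected)
    (ho : IsOpen J) : AEStronglyMeasurable h (volume.restrict J) := by
  have : LocallyIntegrableOn h J volume := by
    intro x hx
    obtain ⟨ε, hε, hI⟩ := exists_Icc_nhds hc ho hx
    have h1 := (hW (x - ε) (hI ⟨le_refl _, by linarith⟩) (x + ε)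
      (hI ⟨by linarith, le_refl _⟩)).1
    rw [intervalIntegrable_iff_integrableOn_Icc_of_le (by linarith)] at h1
    exact ⟨_, mem_nhdsWithin_of_mem_nhds (Icc_mem_nhds (by linarith) (by linarith)), h1⟩
  exact this.aestronglyMeasurable

theorem WD.mul {J : Set ℝ} {g h : ℝ → ℝ} (hW : WD J g h) (hc : J.OrdConnected)
    {u u' : ℝ → ℝ} (hu : ∀ x, HasDerivAt u (u' x) x) (hu' : Continuous u') :
    WD J (fun x => g x * u x) (fun x => h x * u x + g x * u' x) := by
  intro a ha b hb
  have h1 := (hW a ha b hb).1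
  have huc : Continuous u := continuous_iff_continuousAt.2 fun x => (hu x).continuousAt
  have hgc := hW.contOn_uIcc hc ha hb
  refine ⟨(h1.mul_continuousOn huc.continuousOn).add
    ((hgc.mul hu'.continuousOn).intervalIntegrable), ?_⟩
  set G : ℝ → ℝ := fun x => g a + ∫ t in a..x, h t with hG
  have hGg : ∀ x ∈ Set.uIcc a b, G x = g x := fun x hx => by
    have := (hW a ha x (hc.uIcc_subset ha hb hx)).2
    simp only [hG, ← this]; ring
  have hGac : AbsolutelyContinuousOnInterval G a b := by
    have h0 : AbsolutelyContinuousOnInterval (fun _ : ℝ => g a) a b :=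
      (contDiff_const (n := 1)).contDiffOn.absolutelyContinuousOnInterval
    exact h0.add (h1.absolutelyContinuousOnInterval_intervalIntegral (c := a) (by simp))
  have hd : deriv u = u' := funext fun x => (hu x).deriv
  have huac : AbsolutelyContinuousOnInterval u a b := by
    have : ContDiff ℝ 1 u := by
      rw [contDiff_one_iff_deriv]
      exact ⟨fun x => (hu x).differentiableAt, hd ▸ hu'⟩
    exact this.contDiffOn.absolutelyContinuousOnInterval
  have key := hGac.integral_deriv_mul_eq_sub huac
  rw [hGg b (by simp), hGg a (by simp)] at key
  simp only
  rw [← key]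
  apply intervalIntegral.integral_congr_ae
  filter_upwards [h1.ae_hasDerivAt_integral] with x hx hx'
  have hx2 := Set.uIoc_subset_uIcc hx'
  have := ((hx hx2 a (by simp)).const_add (g a)).deriv
  rw [hd, hGg x hx2, this]

namespace Pr
variable {δ β γ : ℝ} {J : Set ℝ} {f : ℝ → ℝ} {κ τ : ℝ}

theorem zero_off (H : Pr δ β γ J f κ τ) {x : ℝ} (hx : x ∉ J) : f x = 0 := by
  rw [H.hJ] at hx
  exact le_antisymm (not_lt.1 hx) (H.nonneg x)

theorem pos_on (H : Pr δ β γ J f κ τ) {x : ℝ} (hx : x ∈ J) : 0 < f x := by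
  rw [H.hJ] at hx; exact hx

theorem intlin (H : Pr δ β γ J f κ τ) : Integrable (fun t => (κ * t - τ) * f t) := by
  have := (H.int1.const_mul κ).sub (H.int0.const_mul τ)
  refine this.congr (ae_of_all _ fun x => ?_)
  simp; ring

theorem qf_nonneg (H : Pr δ β γ J f κ τ) (x : ℝ) : 0 ≤ pq δ β γ x * f x := by
  by_cases hx : x ∈ J
  · exact mul_nonneg (H.qpos x hx).le (H.nonneg x)
  · simp [H.zero_off hx]

theorem lin_eq (H : Pr δ β γ J f κ τ) (t : ℝ) : κ * t - τ = κ * (t - τ / κ) := by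
  have := H.hκ.ne'
  field_simp

theorem ker (H : Pr δ β γ J f κ τ) (x : ℝ) :
    ∫⁻ t, {t | x ∈ Set.uIoc (τ / κ) t}.indicator
      (fun t => ENNReal.ofReal (|κ * t - τ| * f t)) t = ENNReal.ofReal (pq δ β γ x * f x) := by
  have hIic := H.intlin.integrableOn (s := Set.Iic x)
  rcases lt_or_ge (τ / κ) x with hx | hx
  · have hs : {t | x ∈ Set.uIoc (τ / κ) t} = Set.Ici x := by
      ext t; simp only [Set.mem_ofPred_eq, Set.mem_uIoc, Set.mem_Ici]
      constructor
      · rintro (h | h)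
        · exact h.2
        · linarith
      · intro h; exact Or.inl ⟨hx, h⟩
    rw [hs, lintegral_indicator measurableSet_Ici]
    have : ∫⁻ t in Set.Ici x, ENNReal.ofReal (|κ * t - τ| * f t)
        = ∫⁻ t in Set.Ici x, ENNReal.ofReal ((κ * t - τ) * f t) := by
      refine setLIntegral_congr_fun measurableSet_Ici fun t ht => ?_
      have ht : x ≤ t := ht
      have : 0 ≤ κ * t - τ := by
        rw [H.lin_eq]; exact mul_nonneg H.hκ.le (by linarith)
      simp only [abs_of_nonneg this]
    rw [this, ← ofReal_integral_eq_lintegral_ofReal H.intlin.integrableOn]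
    · congr 1
      rw [integral_Ici_eq_integral_Ioi, ← H.eq x]
      have h1 := integral_add_compl (measurableSet_Iic (a := x)) H.intlin
      rw [H.tot, Set.compl_Iic] at h1
      have h2 : ∫ t in Set.Iic x, (τ - κ * t) * f t = - ∫ t in Set.Iic x, (κ * t - τ) * f t := by
        rw [← integral_neg]; congr 1; ext t; ring
      linarith
    · refine (ae_restrict_iff' measurableSet_Ici).2 (ae_of_all _ fun t ht => ?_)
      have ht : x ≤ t := ht
      refine mul_nonneg ?_ (H.nonneg t)
      rw [H.lin_eq]; exact mul_nonneg H.hκ.le (by linarith)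
  · have hs : {t | x ∈ Set.uIoc (τ / κ) t} = Set.Iio x := by
      ext t; simp only [Set.mem_ofPred_eq, Set.mem_uIoc, Set.mem_Iio]
      constructor
      · rintro (h | h)
        · linarith
        · exact h.1
      · intro h; exact Or.inr ⟨h, hx⟩
    rw [hs, lintegral_indicator measurableSet_Iio]
    have hneg : ∀ t ∈ Set.Iio x, κ * t - τ ≤ 0 := fun t ht => by
      have ht : t < x := ht
      rw [H.lin_eq]; exact mul_nonpos_of_nonneg_of_nonpos H.hκ.le (by linarith)
    have : ∫⁻ t in Set.Iio x, ENNReal.ofReal (|κ * t - τ| * f t)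
        = ∫⁻ t in Set.Iio x, ENNReal.ofReal ((τ - κ * t) * f t) := by
      refine setLIntegral_congr_fun measurableSet_Iio fun t ht => ?_
      simp only [abs_of_nonpos (hneg t ht), neg_sub]
    have hI : Integrable (fun t => (τ - κ * t) * f t) := by
      refine H.intlin.neg.congr (ae_of_all _ fun x => ?_)
      simp; ring
    rw [this, ← ofReal_integral_eq_lintegral_ofReal hI.integrableOn]
    · congr 1
      rw [← integral_Iic_eq_integral_Iio, ← H.eq x]
    · refine (ae_restrict_iff' measurableSet_Iio).2 (ae_of_all _ fun t ht => ?_)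
      refine mul_nonneg ?_ (H.nonneg t)
      linarith [hneg t ht]

theorem measurableSet_K (c : ℝ) : MeasurableSet {p : ℝ × ℝ | p.1 ∈ Set.uIoc c p.2} := by
  have : {p : ℝ × ℝ | p.1 ∈ Set.uIoc c p.2} =
      ({p : ℝ × ℝ | c < p.1} ∩ {p | p.1 ≤ p.2}) ∪ ({p | p.2 < p.1} ∩ {p | p.1 ≤ c}) := by
    ext p; simp [Set.mem_uIoc]
  rw [this]
  refine MeasurableSet.union (MeasurableSet.inter ?_ ?_) (MeasurableSet.inter ?_ ?_)
  · exact measurableSet_lt measurable_const measurable_fst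
  · exact measurableSet_le measurable_fst measurable_snd
  · exact measurableSet_lt measurable_snd measurable_fst
  · exact measurableSet_le measurable_fst measurable_const

/-- the kernel -/
def K (f : ℝ → ℝ) (κ τ : ℝ) (p : ℝ × ℝ) : ℝ :=
  {p : ℝ × ℝ | p.1 ∈ Set.uIoc (τ / κ) p.2}.indicator (fun p => |κ * p.2 - τ| * f p.2) p

theorem K_meas (H : Pr δ β γ J f κ τ) : Measurable (K f κ τ) := by
  have := H.meas
  unfold K
  refine Measurable.indicator ?_ (measurableSet_K _)
  fun_prop

theorem K_nonneg (H : Pr δ β γ J f κ τ) (p) : 0 ≤ K f κ τ p :=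
  Set.indicator_nonneg (fun p _ => mul_nonneg (abs_nonneg _) (H.nonneg _)) _

theorem K_lint (H : Pr δ β γ J f κ τ) (x : ℝ) :
    ∫⁻ t, ENNReal.ofReal (K f κ τ (x, t)) = ENNReal.ofReal (pq δ β γ x * f x) := by
  rw [← H.ker x]
  congr 1; ext t
  simp only [K, Set.indicator, Set.mem_ofPred_eq]
  split_ifs <;> simp

theorem tonelli (H : Pr δ β γ J f κ τ) {u : ℝ → ENNReal} (hu : AEMeasurable u) :
    ∫⁻ x, u x * ENNReal.ofReal (pq δ β γ x * f x) =
      ∫⁻ t, ENNReal.ofReal (|κ * t - τ| * f t) * ∫⁻ x in Set.uIoc (τ / κ) t, u x := by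
  have hKm : Measurable (fun p : ℝ × ℝ => ENNReal.ofReal (K f κ τ p)) := H.K_meas.ennreal_ofReal
  have h1 : ∀ x, u x * ENNReal.ofReal (pq δ β γ x * f x) =
      ∫⁻ t, u x * ENNReal.ofReal (K f κ τ (x, t)) := fun x => by
    rw [lintegral_const_mul, H.K_lint]
    exact hKm.comp measurable_prodMk_left
  simp_rw [h1]
  rw [lintegral_lintegral_swap]
  · congr 1; ext t
    rw [← lintegral_indicator measurableSet_uIoc, ← lintegral_const_mul'' _
      (hu.indicator measurableSet_uIoc)]
    congr 1; ext x
    simp only [K, Set.indicator, Set.mem_ofPred_eq]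
    split_ifs <;> simp [mul_comm]
  · exact (hu.comp_fst).mul hKm.aemeasurable

end Pr

namespace Pr
variable {δ β γ : ℝ} {J : Set ℝ} {f : ℝ → ℝ} {κ τ : ℝ}

theorem K_int (H : Pr δ β γ J f κ τ) (x : ℝ) : Integrable (fun t => K f κ τ (x, t)) := by
  refine ⟨(H.K_meas.comp measurable_prodMk_left).aestronglyMeasurable, ?_⟩
  rw [hasFiniteIntegral_iff_ofReal (ae_of_all _ fun t => H.K_nonneg _), H.K_lint]
  exact ENNReal.ofReal_lt_top

theorem K_integral (H : Pr δ β γ J f κ τ) (x : ℝ) :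
    ∫ t, K f κ τ (x, t) = pq δ β γ x * f x := by
  rw [integral_eq_lintegral_of_nonneg_ae (ae_of_all _ fun t => H.K_nonneg _)
    (H.K_int x).aestronglyMeasurable, H.K_lint, ENNReal.toReal_ofReal (H.qf_nonneg x)]

theorem uIoc_sub (H : Pr δ β γ J f κ τ) {t : ℝ} (ht : t ∈ J) : Set.uIoc (τ / κ) t ⊆ J :=
  Set.uIoc_subset_uIcc.trans (H.conn.uIcc_subset H.c_mem ht)

theorem stein (H : Pr δ β γ J f κ τ) {g h : ℝ → ℝ} (hW : WD J g h)
    (hi : Integrable (fun x => h x * (pq δ β γ x * f x))) :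
    Integrable (fun x => g x * ((κ * x - τ) * f x)) ∧
    ∫ x, g x * ((κ * x - τ) * f x) = ∫ x, h x * (pq δ β γ x * f x) := by
  set h' := J.indicator h with hh'
  have hm : AEStronglyMeasurable h' volume :=
    (aestronglyMeasurable_indicator_iff H.isOpen.measurableSet).2 (hW.aesm H.conn H.isOpen)
  have e1 : ∀ x, h' x * (pq δ β γ x * f x) = h x * (pq δ β γ x * f x) := fun x => by
    by_cases hx : x ∈ J
    · simp [hh', hx]
    · simp [hh', hx, H.zero_off hx]
  have hΦ : Integrable (fun p : ℝ × ℝ => h' p.1 * K f κ τ p) (volume.prod volume) := by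
    have hms : AEStronglyMeasurable (fun p : ℝ × ℝ => h' p.1 * K f κ τ p) (volume.prod volume) :=
      hm.comp_fst.mul H.K_meas.aestronglyMeasurable
    rw [integrable_prod_iff hms]
    refine ⟨ae_of_all _ fun x => (H.K_int x).const_mul (h' x), ?_⟩
    refine hi.norm.congr (ae_of_all _ fun x => ?_)
    simp only [norm_mul]
    rw [integral_const_mul]
    have : ∫ t, ‖K f κ τ (x, t)‖ = ∫ t, K f κ τ (x, t) := by
      congr 1; ext t; exact Real.norm_of_nonneg (H.K_nonneg _)
    rw [this, H.K_integral]
    have := e1 x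
    rw [← norm_mul, ← norm_mul, ← e1 x, norm_mul, Real.norm_of_nonneg (H.qf_nonneg x)]
  have e2 : ∀ t, ∫ x, h' x * K f κ τ (x, t) = (g t - g (τ / κ)) * ((κ * t - τ) * f t) := by
    intro t
    by_cases ht : t ∈ J
    · have a1 : ∀ x, h' x * K f κ τ (x, t) =
          (Set.uIoc (τ / κ) t).indicator h x * (|κ * t - τ| * f t) := by
        intro x
        simp only [K, Set.indicator, Set.mem_ofPred_eq, hh']
        by_cases u2 : x ∈ Set.uIoc (τ / κ) t
        · simp [u2, H.uIoc_sub ht u2]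
        · simp [u2]
      simp_rw [a1]
      rw [integral_mul_const, integral_indicator measurableSet_uIoc,
        (hW _ H.c_mem t ht).2, intervalIntegral.intervalIntegral_eq_integral_uIoc]
      split_ifs with hle
      · rw [abs_of_nonneg]
        · simp
        · rw [H.lin_eq]; exact mul_nonneg H.hκ.le (by linarith)
      · rw [abs_of_nonpos]
        · simp only [smul_eq_mul]; ring
        · rw [H.lin_eq]; exact mul_nonpos_of_nonneg_of_nonpos H.hκ.le (by linarith)
    · have a1 : ∀ x, h' x * K f κ τ (x, t) = 0 := by
        intro x
        simp only [K, Set.indicator, Set.mem_ofPred_eq, H.zero_off ht]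
        simp
      simp [a1, H.zero_off ht]
  have i2 := hΦ.integral_prod_right
  simp only [e2] at i2
  have i3 : Integrable (fun x => g x * ((κ * x - τ) * f x)) := by
    refine (i2.add (H.intlin.const_mul (g (τ / κ)))).congr (ae_of_all _ fun x => ?_)
    simp; ring
  refine ⟨i3, ?_⟩
  have sw := integral_integral_swap (f := fun x t => h' x * K f κ τ (x, t)) hΦ
  simp only [e2, integral_const_mul, H.K_integral, e1] at sw
  rw [sw]
  have : ∀ t, (g t - g (τ / κ)) * ((κ * t - τ) * f t) =
    g t * ((κ * t - τ) * f t) - g (τ / κ) * ((κ * t - τ) * f t) := fun t => by ring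
  simp_rw [this]
  rw [integral_sub i3 (H.intlin.const_mul _), integral_const_mul, H.tot]
  simp

/-- transfer of measurability from `J` -/
theorem aesm_mul (H : Pr δ β γ J f κ τ) {g : ℝ → ℝ} (hg : AEStronglyMeasurable g (volume.restrict J)) :
    AEStronglyMeasurable (fun x => g x * f x) volume := by
  have hm : AEStronglyMeasurable (J.indicator g) volume :=
    (aestronglyMeasurable_indicator_iff H.isOpen.measurableSet).2 hg
  refine (hm.mul H.meas.aestronglyMeasurable).congr (ae_of_all _ fun x => ?_)
  by_cases hx : x ∈ J
  · simp [hx]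
  · simp [hx, H.zero_off hx]

theorem cont_aesm (H : Pr δ β γ J f κ τ) {g : ℝ → ℝ} (hg : ContinuousOn g J) :
    AEStronglyMeasurable g (volume.restrict J) :=
  hg.aestronglyMeasurable H.isOpen.measurableSet

/-- dominated integrability on `J` -/
theorem int_mono (H : Pr δ β γ J f κ τ) {g k : ℝ → ℝ} (hg : AEStronglyMeasurable g (volume.restrict J))
    (hk : Integrable (fun x => k x * f x)) (hle : ∀ x ∈ J, |g x| ≤ k x) :
    Integrable (fun x => g x * f x) := by
  refine hk.mono' (H.aesm_mul hg) (ae_of_all _ fun x => ?_)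
  by_cases hx : x ∈ J
  · rw [Real.norm_eq_abs, abs_mul, abs_of_nonneg (H.nonneg x)]
    exact mul_le_mul_of_nonneg_right (hle x hx) (H.nonneg x)
  · simp [H.zero_off hx]

theorem int_of_lin (H : Pr δ β γ J f κ τ) {g : ℝ → ℝ} (hg : ContinuousOn g J)
    (hi : Integrable (fun x => g x * ((κ * x - τ) * f x))) :
    Integrable (fun x => g x * f x) := by
  obtain ⟨ε, hε, hI⟩ := exists_Icc_nhds H.conn H.isOpen H.c_mem
  obtain ⟨C, hC⟩ := isCompact_Icc.exists_bound_of_continuousOn (hg.mono hI)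
  have hκ := H.hκ
  have h1 : Integrable (fun x => (|C| + (κ * ε)⁻¹ * |g x * (κ * x - τ)|) * f x) := by
    refine ((H.int0.const_mul |C|).add (hi.abs.const_mul ((κ * ε)⁻¹))).congr
      (ae_of_all _ fun x => ?_)
    simp only [Pi.add_apply, ← mul_assoc, abs_mul, abs_of_nonneg (H.nonneg x)]
    ring
  refine H.int_mono (H.cont_aesm hg) h1 fun x hx => ?_
  by_cases hxI : x ∈ Set.Icc (τ / κ - ε) (τ / κ + ε)
  · have := hC x hxI
    rw [Real.norm_eq_abs] at this
    have h2 : 0 ≤ (κ * ε)⁻¹ * |g x * (κ * x - τ)| := by positivity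
    linarith [le_abs_self C]
  · have h3 : ε ≤ |x - τ / κ| := by
      by_contra hcon
      rw [not_le, abs_lt] at hcon
      exact hxI ⟨by linarith, by linarith⟩
    have h4 : κ * ε ≤ |κ * x - τ| := by
      rw [H.lin_eq, abs_mul, abs_of_pos hκ]; gcongr
    have h5 : |g x| ≤ (κ * ε)⁻¹ * |g x * (κ * x - τ)| := by
      rw [abs_mul, inv_mul_eq_div, le_div_iff₀ (by positivity)]
      gcongr
    linarith [abs_nonneg C]

theorem q_le (hδ : δ ≤ 0) (x : ℝ) : pq δ β γ x ≤ |β| * |x| + |γ| := by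
  unfold pq
  have h1 : δ * x ^ 2 ≤ 0 := mul_nonpos_of_nonpos_of_nonneg hδ (sq_nonneg x)
  have h2 : β * x ≤ |β| * |x| := by rw [← abs_mul]; exact le_abs_self _
  linarith [le_abs_self γ]

theorem q_cont : Continuous (pq δ β γ) := by unfold pq; fun_prop

/-- multiplication by a polynomial -/
theorem int_poly {u : ℝ → ℝ} {d : ℕ} (h : ∀ k ≤ d, Integrable (fun x => x ^ k * u x))
    (Q : Polynomial ℝ) (hQ : Q.natDegree ≤ d) : Integrable (fun x => Q.eval x * u x) := by
  have : (fun x => Q.eval x * u x) =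
      fun x => ∑ i ∈ Finset.range (d + 1), Q.coeff i * (x ^ i * u x) := by
    ext x
    rw [Polynomial.eval_eq_sum_range' (Nat.lt_succ_of_le hQ), Finset.sum_mul]
    exact Finset.sum_congr rfl fun i _ => by ring
  rw [this]
  exact integrable_finsetSum _ fun i hi => (h i (by simpa [Nat.lt_succ_iff] using hi)).const_mul _

theorem poly_bound (d : ℕ) (Q : Polynomial ℝ) (hQ : Q.natDegree ≤ d) (x : ℝ) :
    |Q.eval x| ≤ ∑ i ∈ Finset.range (d + 1), |Q.coeff i| * |x| ^ i := by
  rw [Polynomial.eval_eq_sum_range' (Nat.lt_succ_of_le hQ)]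
  refine (Finset.abs_sum_le_sum_abs _ _).trans (le_of_eq ?_)
  exact Finset.sum_congr rfl fun i _ => by rw [abs_mul, abs_pow]

/-- integrability of `g Q' q f` -/
theorem int_qderiv (H : Pr δ β γ J f κ τ) {g : ℝ → ℝ} (hg : ContinuousOn g J) {d : ℕ}
    (hi : ∀ k ≤ d, Integrable (fun x => x ^ k * (g x * f x)))
    (Q : Polynomial ℝ) (hQ : Q.natDegree ≤ d) :
    Integrable (fun x => g x * Q.derivative.eval x * (pq δ β γ x * f x)) := by
  rcases Nat.eq_zero_or_pos d with rfl | hd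
  · have : Q.derivative = 0 := Polynomial.derivative_of_natDegree_zero (by omega)
    simp [this]
  have hdeg : Q.derivative.natDegree ≤ d - 1 :=
    (Polynomial.natDegree_derivative_le Q).trans (by omega)
  have h1 : Integrable (fun x => ((∑ i ∈ Finset.range (d - 1 + 1), |Q.derivative.coeff i| * |x| ^ i)
      * (|β| * |x| + |γ|) * |g x|) * f x) := by
    have : (fun x => ((∑ i ∈ Finset.range (d - 1 + 1), |Q.derivative.coeff i| * |x| ^ i)
      * (|β| * |x| + |γ|) * |g x|) * f x) = fun x =>
        ∑ i ∈ Finset.range (d - 1 + 1), (|Q.derivative.coeff i| * |β| * |x ^ (i + 1) * (g x * f x)| +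
          |Q.derivative.coeff i| * |γ| * |x ^ i * (g x * f x)|) := by
      ext x
      simp only [Finset.sum_mul, abs_mul, abs_pow, abs_of_nonneg (H.nonneg x)]
      exact Finset.sum_congr rfl fun i _ => by ring
    rw [this]
    refine integrable_finsetSum _ fun i h => ?_
    rw [Finset.mem_range] at h
    exact ((hi (i + 1) (by omega)).abs.const_mul _).add ((hi i (by omega)).abs.const_mul _)
  have h2 := H.int_mono (g := fun x => g x * Q.derivative.eval x * pq δ β γ x)
    (H.cont_aesm ((hg.mul Q.derivative.continuous.continuousOn).mul q_cont.continuousOn)) h1 ?_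
  · refine h2.congr (ae_of_all _ fun x => ?_)
    ring
  · intro x hx
    rw [abs_mul, abs_mul, abs_of_pos (H.qpos x hx)]
    have a1 := poly_bound (d - 1) _ hdeg x
    have a2 := q_le (β := β) (γ := γ) H.hδ x
    calc |g x| * |Q.derivative.eval x| * pq δ β γ x
        = |Q.derivative.eval x| * pq δ β γ x * |g x| := by ring
      _ ≤ _ := by
        refine mul_le_mul_of_nonneg_right ?_ (abs_nonneg _)
        exact mul_le_mul a1 a2 (H.qpos x hx).le (le_trans (abs_nonneg _) a1)

theorem stein_poly_aux (H : Pr δ β γ J f κ τ) {g h : ℝ → ℝ} (hW : WD J g h) {d : ℕ}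
    (hi : ∀ k ≤ d, Integrable (fun x => x ^ k * (g x * f x)))
    (Q : Polynomial ℝ) (hQ : Q.natDegree ≤ d)
    (hh : Integrable (fun x => Q.eval x * (h x * (pq δ β γ x * f x)))) :
    Integrable (fun x => g x * Q.eval x * ((κ * x - τ) * f x)) ∧
    ∫ x, g x * (((κ * x - τ) * Q.eval x - pq δ β γ x * Q.derivative.eval x) * f x) =
      ∫ x, h x * Q.eval x * (pq δ β γ x * f x) := by
  have hgc := hW.contOn H.conn H.isOpen
  have hW2 := hW.mul H.conn (u := fun x => Q.eval x) (u' := fun x => Q.derivative.eval x)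
    (fun x => Q.hasDerivAt x) Q.derivative.continuous
  have i1 := H.int_qderiv hgc hi Q hQ
  have i0 : Integrable (fun x => h x * Q.eval x * (pq δ β γ x * f x)) :=
    hh.congr (ae_of_all _ fun x => by ring)
  obtain ⟨s1, s2⟩ := H.stein hW2 ((i0.add i1).congr (ae_of_all _ fun x => by
    simp only [Pi.add_apply]; ring))
  refine ⟨s1, ?_⟩
  have e1 : ∀ x, g x * (((κ * x - τ) * Q.eval x - pq δ β γ x * Q.derivative.eval x) * f x) =
    g x * Q.eval x * ((κ * x - τ) * f x) - g x * Q.derivative.eval x * (pq δ β γ x * f x) :=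
    fun x => by ring
  simp_rw [e1]
  rw [integral_sub s1 i1, s2, ← integral_sub _ i1]
  · congr 1; ext x; ring
  · exact (i0.add i1).congr (ae_of_all _ fun x => by simp only [Pi.add_apply]; ring)

theorem stein_int (H : Pr δ β γ J f κ τ) {g h : ℝ → ℝ} (hW : WD J g h) (d : ℕ)
    (hh : ∀ k ≤ d, Integrable (fun x => x ^ k * (h x * (pq δ β γ x * f x)))) :
    ∀ k ≤ d + 1, Integrable (fun x => x ^ k * (g x * f x)) := by
  have hκ := H.hκ
  induction d with
  | zero =>
    have h1 := hh 0 le_rfl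
    simp only [pow_zero, one_mul] at h1
    have s1 := (H.stein hW h1).1
    have s2 := H.int_of_lin (hW.contOn H.conn H.isOpen) s1
    intro k hk
    interval_cases k
    · simpa using s2
    · refine ((s1.const_mul κ⁻¹).add (s2.const_mul (κ⁻¹ * τ))).congr (ae_of_all _ fun x => ?_)
      simp only [Pi.add_apply]; field_simp; ring
  | succ d ih =>
    have ih' := ih fun k hk => hh k (by omega)
    intro k hk
    rcases Nat.lt_or_ge k (d + 2) with hk' | hk'
    · exact ih' k (by omega)
    obtain rfl : k = d + 2 := by omega
    have s1 := (H.stein_poly_aux hW (d := d + 1) ih' (Polynomial.X ^ (d + 1)) (by simp)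
      (by simpa using hh (d + 1) le_rfl)).1
    refine ((s1.const_mul κ⁻¹).add ((ih' (d + 1) le_rfl).const_mul (κ⁻¹ * τ))).congr
      (ae_of_all _ fun x => ?_)
    simp only [Pi.add_apply, Polynomial.eval_pow, Polynomial.eval_X]; field_simp; ring

theorem stein_poly (H : Pr δ β γ J f κ τ) {g h : ℝ → ℝ} (hW : WD J g h) (d : ℕ)
    (hh : ∀ k ≤ d, Integrable (fun x => x ^ k * (h x * (pq δ β γ x * f x))))
    (Q : Polynomial ℝ) (hQ : Q.natDegree ≤ d) :
    ∫ x, g x * (((κ * x - τ) * Q.eval x - pq δ β γ x * Q.derivative.eval x) * f x) =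
      ∫ x, h x * Q.eval x * (pq δ β γ x * f x) :=
  (H.stein_poly_aux hW (fun k hk => H.stein_int hW d hh k (by omega)) Q hQ
    (int_poly hh Q hQ)).2

end Pr


theorem mean_mem {J : Set ℝ} {f : ℝ → ℝ} {c : ℝ} (hc : J.OrdConnected) (ho : IsOpen J)
    (hne : J.Nonempty) (hJ : J = {x | 0 < f x}) (hf : ∀ x, 0 ≤ f x)
    (hi : Integrable (fun t => (t - c) * f t)) (h0 : ∫ t, (t - c) * f t = 0) : c ∈ J := by
  by_contra hcJ
  have hoff : ∀ x, x ∉ J → f x = 0 := fun x hx => by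
    rw [hJ] at hx; exact le_antisymm (not_lt.1 hx) (hf x)
  have hcon : ∀ s : ℝ, s ≠ 0 → (∀ x, 0 ≤ s * ((x - c) * f x)) → False := by
    intro s hs hs'
    have h1 : ∫ x, s * ((x - c) * f x) = 0 := by rw [integral_const_mul, h0, mul_zero]
    rw [integral_eq_zero_iff_of_nonneg hs' (hi.const_mul s)] at h1
    have h2 : volume J = 0 := by
      refine measure_mono_null ?_ h1
      intro x hx
      have hfx : 0 < f x := by rw [hJ] at hx; exact hx
      have hxc : x - c ≠ 0 := fun h => hcJ (by rwa [← sub_eq_zero.1 h])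
      simp only [Set.mem_compl_iff, Set.mem_ofPred_eq, Pi.zero_apply]
      exact mul_ne_zero hs (mul_ne_zero hxc hfx.ne')
    exact (ho.measure_pos volume hne).ne' h2
  obtain ⟨y, hy⟩ := hne
  have hyc : y ≠ c := fun h => hcJ (h ▸ hy)
  rcases lt_or_gt_of_ne hyc with h | h
  · refine hcon (-1) (by norm_num) fun x => ?_
    by_cases hx : x ∈ J
    · have : x < c := by
        by_contra hxc
        exact hcJ (hc.out hy hx ⟨h.le, not_lt.1 hxc⟩)
      nlinarith [hf x]
    · simp [hoff x hx]
  · refine hcon 1 (by norm_num) fun x => ?_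
    by_cases hx : x ∈ J
    · have : c < x := by
        by_contra hxc
        exact hcJ (hc.out hx hy ⟨not_lt.1 hxc, h.le⟩)
      nlinarith [hf x]
    · simp [hoff x hx]

theorem cs_interval {a b : ℝ} {h : ℝ → ℝ} (hi : IntervalIntegrable h volume a b) :
    ENNReal.ofReal ((∫ t in a..b, h t) ^ 2) ≤
      ENNReal.ofReal |b - a| * ∫⁻ x in Set.uIoc a b, ENNReal.ofReal (h x ^ 2) := by
  have hm : AEMeasurable (fun x => ENNReal.ofReal |h x|) (volume.restrict (Set.uIoc a b)) :=
    (intervalIntegrable_iff.1 hi).aestronglyMeasurable.aemeasurable.norm.ennreal_ofReal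
  have h1 : ENNReal.ofReal |∫ t in a..b, h t| ≤ ∫⁻ x in Set.uIoc a b, ENNReal.ofReal |h x| := by
    rw [← ofReal_integral_eq_lintegral_ofReal (intervalIntegrable_iff.1 hi).abs
      (ae_of_all _ fun x => abs_nonneg _)]
    have h0 := intervalIntegral.norm_integral_le_integral_norm_uIoc (f := h) (a := a) (b := b)
      (μ := volume)
    exact ENNReal.ofReal_le_ofReal (by simpa only [Real.norm_eq_abs] using h0)
  have h2 := ENNReal.lintegral_mul_le_Lp_mul_Lq (volume.restrict (Set.uIoc a b))
    (p := 2) (q := 2) ⟨by norm_num, by norm_num, by norm_num⟩ hm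
    (g := fun _ => 1) aemeasurable_const
  have h3 : ∀ x, (ENNReal.ofReal |h x|) ^ (2 : ℝ) = ENNReal.ofReal (h x ^ 2) := fun x => by
    rw [ENNReal.ofReal_rpow_of_nonneg (abs_nonneg _) (by norm_num)]
    simp
  simp only [Pi.mul_apply, mul_one, h3, ENNReal.one_rpow, lintegral_const, one_mul,
    Measure.restrict_apply MeasurableSet.univ, Set.univ_inter] at h2
  have h4 : volume (Set.uIoc a b) = ENNReal.ofReal |b - a| := by
    rw [Set.uIoc, Real.volume_Ioc, max_sub_min_eq_abs]
  rw [h4] at h2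
  have h5 : ENNReal.ofReal ((∫ t in a..b, h t) ^ 2) =
      (ENNReal.ofReal |∫ t in a..b, h t|) ^ 2 := by
    rw [← ENNReal.ofReal_pow (abs_nonneg _), sq_abs]
  rw [h5]
  calc _ ≤ ((∫⁻ x in Set.uIoc a b, ENNReal.ofReal (h x ^ 2)) ^ (1 / 2 : ℝ) *
        ENNReal.ofReal |b - a| ^ (1 / 2 : ℝ)) ^ 2 := by
        gcongr; exact h1.trans h2
    _ = _ := by
        rw [mul_pow, ← ENNReal.rpow_natCast, ← ENNReal.rpow_natCast, ← ENNReal.rpow_mul,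
          ← ENNReal.rpow_mul]
        norm_num [mul_comm]

namespace Pr
variable {δ β γ : ℝ} {J : Set ℝ} {f : ℝ → ℝ} {κ τ : ℝ}

theorem poincare (H : Pr δ β γ J f κ τ) {g h : ℝ → ℝ} (hW : WD J g h)
    (hi : Integrable (fun x => h x ^ 2 * (pq δ β γ x * f x))) :
    Integrable (fun x => g x ^ 2 * f x) := by
  have hgc := hW.contOn H.conn H.isOpen
  have hκ := H.hκ
  set h' := J.indicator h with hh'
  have hm : AEStronglyMeasurable h' volume :=
    (aestronglyMeasurable_indicator_iff H.isOpen.measurableSet).2 (hW.aesm H.conn H.isOpen)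
  have hT := H.tonelli (u := fun x => ENNReal.ofReal (h' x ^ 2))
    (hm.aemeasurable.pow_const 2).ennreal_ofReal
  have e1 : ∫⁻ x, ENNReal.ofReal (h' x ^ 2) * ENNReal.ofReal (pq δ β γ x * f x) =
      ∫⁻ x, ENNReal.ofReal (h x ^ 2 * (pq δ β γ x * f x)) := by
    congr 1; ext x
    rw [← ENNReal.ofReal_mul (sq_nonneg _)]
    by_cases hx : x ∈ J
    · simp [hh', hx]
    · simp [hh', hx, H.zero_off hx]
  rw [e1] at hT
  have hfin : ∫⁻ x, ENNReal.ofReal (h x ^ 2 * (pq δ β γ x * f x)) < ⊤ := by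
    have := hi.2
    rwa [hasFiniteIntegral_iff_ofReal (ae_of_all _ fun x =>
      mul_nonneg (sq_nonneg _) (H.qf_nonneg x))] at this
  rw [hT] at hfin
  have i1 : Integrable (fun x => (κ * (g x - g (τ / κ)) ^ 2) * f x) := by
    refine ⟨H.aesm_mul (H.cont_aesm (by fun_prop)), ?_⟩
    rw [hasFiniteIntegral_iff_ofReal (ae_of_all _ fun x => by
      have := H.nonneg x
      positivity)]
    refine lt_of_le_of_lt (lintegral_mono fun t => ?_) hfin
    by_cases ht : t ∈ J
    · have h1 := cs_interval (hW _ H.c_mem t ht).1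
      rw [← (hW _ H.c_mem t ht).2] at h1
      have h2 : ∫⁻ x in Set.uIoc (τ / κ) t, ENNReal.ofReal (h x ^ 2) =
          ∫⁻ x in Set.uIoc (τ / κ) t, ENNReal.ofReal (h' x ^ 2) := by
        refine setLIntegral_congr_fun measurableSet_uIoc fun x hx => ?_
        simp [hh', H.uIoc_sub ht hx]
      rw [h2] at h1
      rw [H.lin_eq, abs_mul, abs_of_pos hκ]
      calc ENNReal.ofReal (κ * (g t - g (τ / κ)) ^ 2 * f t)
          = ENNReal.ofReal (κ * f t) * ENNReal.ofReal ((g t - g (τ / κ)) ^ 2) := by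
            rw [← ENNReal.ofReal_mul (mul_nonneg hκ.le (H.nonneg t))]; congr 1; ring
        _ ≤ ENNReal.ofReal (κ * f t) * (ENNReal.ofReal |t - τ / κ| * _) := by gcongr
        _ = _ := by
            rw [← mul_assoc, ← ENNReal.ofReal_mul (mul_nonneg hκ.le (H.nonneg t))]
            congr 2; ring
    · simp [H.zero_off ht]
  refine H.int_mono (g := fun x => g x ^ 2)
    (k := fun x => 2 * κ⁻¹ * (κ * (g x - g (τ / κ)) ^ 2) + 2 * g (τ / κ) ^ 2)
    (H.cont_aesm (hgc.pow 2)) ?_ ?_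
  · refine ((i1.const_mul (2 * κ⁻¹)).add (H.int0.const_mul (2 * g (τ / κ) ^ 2))).congr
      (ae_of_all _ fun x => ?_)
    simp only [Pi.add_apply]; ring
  · intro x _
    have : 2 * κ⁻¹ * (κ * (g x - g (τ / κ)) ^ 2) = 2 * (g x - g (τ / κ)) ^ 2 := by
      field_simp
    rw [this, abs_of_nonneg (sq_nonneg _)]
    nlinarith [sq_nonneg (g x - 2 * g (τ / κ))]

theorem wd_of_deriv {u u' : ℝ → ℝ} (J : Set ℝ) (hu : ∀ x, HasDerivAt u (u' x) x)
    (hu' : Continuous u') : WD J u u' := fun a _ b _ =>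
  ⟨hu'.intervalIntegrable _ _,
    (intervalIntegral.integral_eq_sub_of_hasDerivAt (fun x _ => hu x)
      (hu'.intervalIntegrable _ _)).symm⟩

theorem moments (H : Pr δ β γ J f κ τ) (N : ℕ) : Integrable (fun x => x ^ N * f x) := by
  suffices ∀ N, ∀ k ≤ N + 1, Integrable (fun x => x ^ k * f x) from this N N (by omega)
  intro N
  induction N with
  | zero =>
    intro k hk
    interval_cases k
    · simpa using H.int0
    · simpa using H.int1
  | succ N ih =>
    have h1 : WD J (fun x => x) (fun _ => 1) :=
      wd_of_deriv J (fun x => hasDerivAt_id x) continuous_const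
    have h2 := H.stein_int h1 N (fun k hk => by
      have := H.int_qderiv (g := fun _ => 1) continuousOn_const (d := k + 1)
        (fun j hj => by simpa using ih j (by omega)) (Polynomial.X ^ (k + 1)) (by simp)
      refine (this.const_mul ((k : ℝ) + 1)⁻¹).congr (ae_of_all _ fun x => ?_)
      have hk : (k : ℝ) + 1 ≠ 0 := by positivity
      simp
      field_simp)
    intro k hk
    rcases Nat.eq_zero_or_pos k with rfl | hk0
    · simpa using H.int0
    · obtain ⟨j, rfl⟩ : ∃ j, k = j + 1 := ⟨k - 1, by omega⟩
      refine (h2 j (by omega)).congr (ae_of_all _ fun x => ?_)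
      simp only; ring

theorem int_poly' (H : Pr δ β γ J f κ τ) (Q : Polynomial ℝ) :
    Integrable (fun x => Q.eval x * f x) :=
  int_poly (fun k _ => H.moments k) Q le_rfl

/-- pq as a polynomial -/
def qP (δ β γ : ℝ) : Polynomial ℝ :=
  Polynomial.C δ * Polynomial.X ^ 2 + Polynomial.C β * Polynomial.X + Polynomial.C γ

theorem qP_eval (x : ℝ) : (qP δ β γ).eval x = pq δ β γ x := by simp [qP, pq]

theorem q_deriv (x : ℝ) : HasDerivAt (pq δ β γ) (2 * δ * x + β) x := by
  have := (qP δ β γ).hasDerivAt x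
  have e : (fun x => (qP δ β γ).eval x) = pq δ β γ := funext qP_eval
  rw [e] at this
  have h2 : (qP δ β γ).derivative.eval x = 2 * δ * x + β := by simp [qP]; ring
  rw [h2] at this; exact this

theorem step (H : Pr δ β γ J f κ τ) :
    Pr δ β γ J (fun x => pq δ β γ x * f x) (κ - 2 * δ) (τ + β) := by
  have hκ := H.hκ
  have hδ := H.hδ
  have hκ' : 0 < κ - 2 * δ := by linarith
  have hJ : J = {x | 0 < pq δ β γ x * f x} := by
    ext x
    constructor
    · intro hx; exact mul_pos (H.qpos x hx) (H.pos_on hx)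
    · intro hx
      by_contra hxJ
      simp [H.zero_off hxJ] at hx
  have i0 : Integrable (fun x => pq δ β γ x * f x) := by
    simpa [qP_eval] using H.int_poly' (qP δ β γ)
  have i1 : Integrable (fun x => x * (pq δ β γ x * f x)) := by
    refine (H.int_poly' (Polynomial.X * qP δ β γ)).congr (ae_of_all _ fun x => ?_)
    simp [qP_eval, mul_assoc]
  have ih : Integrable (fun x => (2 * δ * x + β) * (pq δ β γ x * f x)) := by
    refine ((i1.const_mul (2 * δ)).add (i0.const_mul β)).congr (ae_of_all _ fun x => ?_)
    simp only [Pi.add_apply]; ring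
  have hcq' : Continuous (fun x : ℝ => 2 * δ * x + β) := by fun_prop
  have htot : ∫ t, ((κ - 2 * δ) * t - (τ + β)) * (pq δ β γ t * f t) = 0 := by
    have hW : WD J (pq δ β γ) (fun x => 2 * δ * x + β) := wd_of_deriv J q_deriv hcq'
    obtain ⟨s1, s2⟩ := H.stein hW ih
    rw [← sub_eq_zero, ← integral_sub s1 ih] at s2
    rw [← s2]
    congr 1; ext x; ring
  refine ⟨hδ, hκ', H.qf_nonneg, (q_cont.measurable).mul H.meas, hJ, H.conn, H.isOpen, ?_, i0, i1,
    htot, ?_, H.qpos⟩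
  · have e : ∀ t, ((κ - 2 * δ) * t - (τ + β)) * (pq δ β γ t * f t) =
      (κ - 2 * δ) * ((t - (τ + β) / (κ - 2 * δ)) * (pq δ β γ t * f t)) := fun t => by
      field_simp
    have hi : Integrable (fun t => (t - (τ + β) / (κ - 2 * δ)) * (pq δ β γ t * f t)) := by
      refine (i1.sub (i0.const_mul ((τ + β) / (κ - 2 * δ)))).congr (ae_of_all _ fun x => ?_)
      simp only [Pi.sub_apply]; ring
    refine mean_mem H.conn H.isOpen ⟨_, H.c_mem⟩ hJ H.qf_nonneg hi ?_
    simp_rw [e, integral_const_mul] at htot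
    exact (mul_eq_zero.1 htot).resolve_left hκ'.ne'
  · intro x
    have hW : WD J (fun t => pq δ β γ (min t x))
        ((Set.Iic x).indicator (fun t => 2 * δ * t + β)) := by
      intro a _ b _
      have hIntg : IntervalIntegrable ((Set.Iic x).indicator (fun t => 2 * δ * t + β))
          volume a b := by
        rw [intervalIntegrable_iff]
        exact (intervalIntegrable_iff.1 (hcq'.intervalIntegrable a b)).indicator measurableSet_Iic
      refine ⟨hIntg, ?_⟩
      refine (integral_eq_of_hasDerivAt_off_countable (fun t => pq δ β γ (min t x)) _ (Set.countable_singleton x)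
        ?_ ?_ hIntg).symm
      · exact (q_cont.comp (by fun_prop)).continuousOn
      · rintro y ⟨-, hy⟩
        rcases lt_or_gt_of_ne (show y ≠ x from hy) with h | h
        · rw [Set.indicator_of_mem (show y ∈ Set.Iic x from h.le)]
          refine (q_deriv (γ := γ) y).congr_of_eventuallyEq ?_
          filter_upwards [Iio_mem_nhds h] with z hz
          rw [min_eq_left (le_of_lt hz)]
        · rw [Set.indicator_of_notMem (show y ∉ Set.Iic x from not_le.2 h)]
          refine (hasDerivAt_const y (pq δ β γ x)).congr_of_eventuallyEq ?_
          filter_upwards [Ioi_mem_nhds h] with z hz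
          rw [min_eq_right (le_of_lt hz)]
    have ei : ∀ t, (Set.Iic x).indicator (fun t => 2 * δ * t + β) t * (pq δ β γ t * f t) =
        (Set.Iic x).indicator (fun t => (2 * δ * t + β) * (pq δ β γ t * f t)) t := fun t => by
      simp only [Set.indicator]; split_ifs <;> simp
    obtain ⟨s1, s2⟩ := H.stein hW (by
      simp_rw [ei]; exact ih.indicator measurableSet_Iic)
    simp_rw [ei] at s2
    rw [integral_indicator measurableSet_Iic] at s2
    rw [← integral_add_compl measurableSet_Iic s1, Set.compl_Iic] at s2
    have a1 : ∫ t in Set.Iic x, pq δ β γ (min t x) * ((κ * t - τ) * f t) =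
        ∫ t in Set.Iic x, pq δ β γ t * ((κ * t - τ) * f t) := by
      refine setIntegral_congr_fun measurableSet_Iic fun t ht => ?_
      simp only [min_eq_left (show t ≤ x from ht)]
    have a2 : ∫ t in Set.Ioi x, pq δ β γ (min t x) * ((κ * t - τ) * f t) =
        pq δ β γ x * ∫ t in Set.Ioi x, (κ * t - τ) * f t := by
      rw [← integral_const_mul]
      refine setIntegral_congr_fun measurableSet_Ioi fun t ht => ?_
      simp only [min_eq_right (le_of_lt (show x < t from ht))]
    have a3 : ∫ t in Set.Ioi x, (κ * t - τ) * f t = pq δ β γ x * f x := by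
      have h1 := integral_add_compl (measurableSet_Iic (a := x)) H.intlin
      rw [H.tot, Set.compl_Iic] at h1
      have h2 : ∫ t in Set.Iic x, (τ - κ * t) * f t = - ∫ t in Set.Iic x, (κ * t - τ) * f t := by
        rw [← integral_neg]; congr 1; ext t; ring
      have h3 := H.eq x
      linarith
    have i4 : Integrable (fun t => pq δ β γ t * ((κ * t - τ) * f t)) := by
      refine ((i1.const_mul κ).sub (i0.const_mul τ)).congr (ae_of_all _ fun x => ?_)
      simp only [Pi.sub_apply]; ring
    have a4 : ∫ t in Set.Iic x, (τ + β - (κ - 2 * δ) * t) * (pq δ β γ t * f t) =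
        (∫ t in Set.Iic x, (2 * δ * t + β) * (pq δ β γ t * f t)) -
        ∫ t in Set.Iic x, pq δ β γ t * ((κ * t - τ) * f t) := by
      rw [← integral_sub ih.integrableOn i4.integrableOn]
      congr 1; ext t; ring
    rw [a1, a2, a3] at s2
    rw [a4, ← s2]; ring

end Pr


namespace Pr
variable {δ β γ : ℝ} {J : Set ℝ} {f : ℝ → ℝ} {κ τ : ℝ}

theorem even_moments (H : Pr δ β γ J f κ τ) :
    ∃ C : ℝ, 0 < C ∧ ∀ k : ℕ, Integrable (fun x => (x - τ / κ) ^ (2 * k) * f x) ∧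
      ∫ x, (x - τ / κ) ^ (2 * k) * f x ≤ C ^ k * (2 * k).factorial * ∫ x, f x := by
  have hκ := H.hκ
  set c := τ / κ with hc
  set D := |β| + |β| * |c| + |γ| + 1 with hD
  have hD0 : 0 < D := by positivity
  have hI : ∀ N : ℕ, Integrable (fun x => (x - c) ^ N * f x) := fun N => by
    refine (H.int_poly' ((Polynomial.X - Polynomial.C c) ^ N)).congr (ae_of_all _ fun x => ?_)
    simp
  refine ⟨2 * D / κ + D ^ 2 / κ ^ 2, by positivity, fun k => ⟨hI _, ?_⟩⟩
  set C := 2 * D / κ + D ^ 2 / κ ^ 2 with hC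
  have hC0 : 0 < C := by positivity
  have hqb : ∀ x, pq δ β γ x ≤ D * (1 + |x - c|) := fun x => by
    refine (q_le H.hδ x).trans ?_
    have h1 : |x| ≤ |x - c| + |c| := by
      calc |x| = |(x - c) + c| := by ring_nf
        _ ≤ _ := abs_add_le _ _
    have h2 := mul_le_mul_of_nonneg_left h1 (abs_nonneg β)
    have h3 : 0 ≤ |β| * |c| * |x - c| := by positivity
    have h4 : 0 ≤ |γ| * |x - c| := by positivity
    rw [hD]
    nlinarith [abs_nonneg (x - c), abs_nonneg β]
  have hnn : ∀ k : ℕ, 0 ≤ ∫ x, (x - c) ^ (2 * k) * f x := fun k =>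
    integral_nonneg fun x => mul_nonneg (by rw [pow_mul]; positivity) (H.nonneg x)
  have hstep : ∀ k : ℕ, ∫ x, (x - c) ^ (2 * (k + 1)) * f x ≤
      (2 * k + 1 : ℝ) ^ 2 * C * ∫ x, (x - c) ^ (2 * k) * f x := fun k => by
    have hW : WD J (fun x => (x - c) ^ (2 * k + 1))
        (fun x => (2 * k + 1 : ℝ) * (x - c) ^ (2 * k)) := by
      refine wd_of_deriv J (fun x => ?_) (by fun_prop)
      have := ((hasDerivAt_id x).sub_const c).pow (2 * k + 1)
      exact this.congr_deriv (by simp)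
    have hi : Integrable (fun x => (2 * k + 1 : ℝ) * (x - c) ^ (2 * k) * (pq δ β γ x * f x)) := by
      refine (H.int_poly' (Polynomial.C (2 * k + 1 : ℝ) *
        (Polynomial.X - Polynomial.C c) ^ (2 * k) * qP δ β γ)).congr (ae_of_all _ fun x => ?_)
      simp [qP_eval]; ring
    obtain ⟨s1, s2⟩ := H.stein hW hi
    have e1 : ∫ x, (x - c) ^ (2 * k + 1) * ((κ * x - τ) * f x) =
        κ * ∫ x, (x - c) ^ (2 * (k + 1)) * f x := by
      rw [← integral_const_mul]; congr 1; ext x; rw [H.lin_eq]; ring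
    rw [e1] at s2
    have hle : ∫ x, (2 * k + 1 : ℝ) * (x - c) ^ (2 * k) * (pq δ β γ x * f x) ≤
        ∫ x, (κ / 2 * ((x - c) ^ (2 * (k + 1)) * f x) +
          (2 * k + 1 : ℝ) ^ 2 * (D + D ^ 2 / (2 * κ)) * ((x - c) ^ (2 * k) * f x)) := by
      refine integral_mono hi (((hI _).const_mul _).add ((hI _).const_mul _)) fun x => ?_
      have h1 : (2 * k + 1 : ℝ) * pq δ β γ x ≤ κ / 2 * (x - c) ^ 2 +
          (2 * k + 1 : ℝ) ^ 2 * (D + D ^ 2 / (2 * κ)) := by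
        have hN : (1 : ℝ) ≤ 2 * k + 1 := by have : (0 : ℝ) ≤ k := by positivity
                                            linarith
        set N : ℝ := 2 * k + 1
        have h2 := mul_le_mul_of_nonneg_left (hqb x) (by linarith : 0 ≤ N)
        have h3 : 0 ≤ (κ * |x - c| - N * D) ^ 2 / (2 * κ) := by positivity
        have h4 : (κ * |x - c| - N * D) ^ 2 / (2 * κ) =
          κ / 2 * (x - c) ^ 2 - N * D * |x - c| + N ^ 2 * (D ^ 2 / (2 * κ)) := by
          rw [← sq_abs (x - c)]; field_simp; ring
        have h5 : N * D ≤ N ^ 2 * D := mul_le_mul_of_nonneg_right (by nlinarith) hD0.le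
        nlinarith
      have h2 : 0 ≤ (x - c) ^ (2 * k) * f x :=
        mul_nonneg (by rw [pow_mul]; positivity) (H.nonneg x)
      have h3 := mul_le_mul_of_nonneg_right h1 h2
      simp only
      calc _ = (2 * k + 1 : ℝ) * pq δ β γ x * ((x - c) ^ (2 * k) * f x) := by ring
        _ ≤ _ := h3
        _ = _ := by ring
    rw [integral_add ((hI _).const_mul _) ((hI _).const_mul _), integral_const_mul,
      integral_const_mul, ← s2] at hle
    have h6 : (2 * k + 1 : ℝ) ^ 2 * C * ∫ x, (x - c) ^ (2 * k) * f x =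
       2 / κ * ((2 * k + 1 : ℝ) ^ 2 * (D + D ^ 2 / (2 * κ)) * ∫ x, (x - c) ^ (2 * k) * f x) := by
      rw [hC]; field_simp
    rw [h6, div_mul_eq_mul_div, le_div_iff₀ hκ]
    linarith
  induction k with
  | zero => simp
  | succ k ih =>
    refine (hstep k).trans ?_
    have h1 : (2 * k + 1 : ℝ) ^ 2 * C * ∫ x, (x - c) ^ (2 * k) * f x ≤
      (2 * k + 1 : ℝ) ^ 2 * C * (C ^ k * (2 * k).factorial * ∫ x, f x) := by gcongr
    refine h1.trans ?_
    have h2 : (2 * (k + 1)).factorial = (2 * k + 2) * ((2 * k + 1) * (2 * k).factorial) := rfl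
    rw [h2]
    push_cast
    have h3 : 0 ≤ C ^ (k + 1) * (2 * k).factorial * ∫ x, f x := by
      have := hnn 0
      simp at this
      positivity
    have h4 : (2 * k + 1 : ℝ) ^ 2 ≤ (2 * k + 2) * (2 * k + 1) := by
      have : (0 : ℝ) ≤ k := by positivity
      nlinarith
    have h5 := mul_le_mul_of_nonneg_right h4 h3
    calc _ = (2 * k + 1 : ℝ) ^ 2 * (C ^ (k + 1) * (2 * k).factorial * ∫ x, f x) := by ring
      _ ≤ _ := h5
      _ = _ := by ring

theorem exp_moment (H : Pr δ β γ J f κ τ) :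
    ∃ ε : ℝ, 0 < ε ∧ Integrable (fun x => Real.exp (ε * |x|) * f x) := by
  obtain ⟨C, hC, hk⟩ := H.even_moments
  set c := τ / κ with hc
  set ε := (Real.sqrt (2 * C))⁻¹ with hε
  have hε0 : 0 < ε := by positivity
  have hε2 : ε ^ 2 * C = 1 / 2 := by
    rw [hε, inv_pow, Real.sq_sqrt (by positivity)]; field_simp
  refine ⟨ε, hε0, ?_⟩
  have hcosh : Integrable (fun x => Real.cosh (ε * (x - c)) * f x) := by
    refine ⟨((Real.continuous_cosh.comp (by fun_prop)).measurable.mul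
      H.meas).aestronglyMeasurable, ?_⟩
    rw [hasFiniteIntegral_iff_ofReal (ae_of_all _ fun x =>
      mul_nonneg (Real.cosh_pos _).le (H.nonneg x))]
    have e : ∀ x, ENNReal.ofReal (Real.cosh (ε * (x - c)) * f x) =
        ∑' k : ℕ, ENNReal.ofReal ((ε ^ 2) ^ k / (2 * k).factorial * ((x - c) ^ (2 * k) * f x)) := by
      intro x
      have h1 := (Real.hasSum_cosh (ε * (x - c))).mul_right (f x)
      rw [← h1.tsum_eq, ENNReal.ofReal_tsum_of_nonneg _ h1.summable]
      · congr 1; ext k; congr 1; rw [mul_pow, pow_mul]; ring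
      · intro k
        have := H.nonneg x
        rw [pow_mul]; positivity
    simp_rw [e]
    rw [lintegral_tsum]
    · have h2 : ∀ k : ℕ, ∫⁻ x, ENNReal.ofReal ((ε ^ 2) ^ k / (2 * k).factorial *
          ((x - c) ^ (2 * k) * f x)) ≤ ENNReal.ofReal ((1 / 2) ^ k * ∫ x, f x) := fun k => by
        rw [← ofReal_integral_eq_lintegral_ofReal ((hk k).1.const_mul _) (ae_of_all _ fun x => by
          have := H.nonneg x
          simp only [Pi.zero_apply]
          rw [pow_mul]; positivity)]
        apply ENNReal.ofReal_le_ofReal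
        rw [integral_const_mul]
        calc _ ≤ (ε ^ 2) ^ k / (2 * k).factorial * (C ^ k * (2 * k).factorial * ∫ x, f x) := by
              gcongr; exact (hk k).2
          _ = (ε ^ 2 * C) ^ k * ∫ x, f x := by
              have : ((2 * k).factorial : ℝ) ≠ 0 := by positivity
              rw [mul_pow]; field_simp
          _ = _ := by rw [hε2]
      refine lt_of_le_of_lt (ENNReal.tsum_le_tsum h2) ?_
      rw [← ENNReal.ofReal_tsum_of_nonneg]
      · exact ENNReal.ofReal_lt_top
      · intro k
        have := integral_nonneg (μ := volume) (f := f) (fun x => H.nonneg x)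
        positivity
      · exact summable_geometric_two.mul_right _
    · intro k
      exact (((((measurable_id.sub_const c).pow_const (2 * k)).mul H.meas).const_mul
        _).ennreal_ofReal).aemeasurable
  refine H.int_mono (g := fun x => Real.exp (ε * |x|))
    (k := fun x => 2 * Real.exp (ε * |c|) * Real.cosh (ε * (x - c)))
    (H.cont_aesm (by fun_prop)) ?_ ?_
  · refine (hcosh.const_mul (2 * Real.exp (ε * |c|))).congr (ae_of_all _ fun x => ?_)
    simp only; ring
  · intro x _
    rw [abs_of_pos (Real.exp_pos _), Real.cosh_eq]
    have h1 : |x| ≤ |c| + |x - c| := by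
      calc |x| = |c + (x - c)| := by ring_nf
        _ ≤ _ := abs_add_le _ _
    have h2 : Real.exp (ε * |x|) ≤ Real.exp (ε * |c|) * Real.exp (ε * |x - c|) := by
      rw [← Real.exp_add, Real.exp_le_exp]; nlinarith
    have h3 : Real.exp (ε * |x - c|) ≤ Real.exp (ε * (x - c)) + Real.exp (-(ε * (x - c))) := by
      rcases abs_cases (x - c) with ⟨h, _⟩ | ⟨h, _⟩ <;> rw [h]
      · linarith [Real.exp_pos (-(ε * (x - c)))]
      · rw [mul_neg]; linarith [Real.exp_pos (ε * (x - c))]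
    have h4 := mul_le_mul_of_nonneg_left h3 (Real.exp_pos (ε * |c|)).le
    calc _ ≤ _ := h2.trans h4
      _ = _ := by ring

end Pr


theorem ioo_sub_expSet {μ : Measure ℝ} {ε : ℝ} 
    (h : Integrable (fun x => Real.exp (ε * |x|)) μ) :
    Set.Ioo (-ε) ε ⊆ interior (integrableExpSet id μ) := by
  refine interior_maximal ?_ isOpen_Ioo
  intro t ht
  refine h.mono' (by fun_prop) (ae_of_all _ fun x => ?_)
  rw [Real.norm_eq_abs, abs_of_pos (Real.exp_pos _), Real.exp_le_exp, id]
  calc t * x ≤ |t| * |x| := by rw [← abs_mul]; exact le_abs_self _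
    _ ≤ _ := mul_le_mul_of_nonneg_right (abs_lt.2 ht).le (abs_nonneg _)

theorem moment_determinacy {μ ν : Measure ℝ} [IsFiniteMeasure μ] [IsFiniteMeasure ν] {ε : ℝ}
    (hε : 0 < ε) (hμ : Integrable (fun x => Real.exp (ε * |x|)) μ)
    (hν : Integrable (fun x => Real.exp (ε * |x|)) ν)
    (hm : ∀ k : ℕ, ∫ x, x ^ k ∂μ = ∫ x, x ^ k ∂ν) : μ = ν := by
  have aμ := (analyticOnNhd_complexMGF (X := id) (μ := μ)).mono
    (fun (z : ℂ) (hz : z ∈ Complex.reLm ⁻¹' Set.Ioo (-ε) ε) => ioo_sub_expSet hμ hz)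
  have aν := (analyticOnNhd_complexMGF (X := id) (μ := ν)).mono
    (fun (z : ℂ) (hz : z ∈ Complex.reLm ⁻¹' Set.Ioo (-ε) ε) => ioo_sub_expSet hν hz)
  have h0 : (0 : ℂ) ∈ Complex.reLm ⁻¹' Set.Ioo (-ε) ε := by simp [hε]
  have hd : ∀ n, iteratedDeriv n (complexMGF id μ) 0 = iteratedDeriv n (complexMGF id ν) 0 := by
    intro n
    have h0' : (0 : ℂ).re ∈ Set.Ioo (-ε) ε := h0
    rw [iteratedDeriv_complexMGF (ioo_sub_expSet hμ h0'),
      iteratedDeriv_complexMGF (ioo_sub_expSet hν h0')]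
    have := hm n
    simp only [id, zero_mul, Complex.exp_zero, mul_one]
    have h2 := congrArg (fun r : ℝ => (r : ℂ)) this
    simp only [← integral_complex_ofReal] at h2
    simpa using h2
  have s1 := (aμ 0 h0).hasFPowerSeriesAt
  have s2 := (aν 0 h0).hasFPowerSeriesAt
  simp only [hd] at s1
  have hev : complexMGF id μ =ᶠ[nhds 0] complexMGF id ν := by
    have := s1.sub s2
    rw [sub_self] at this
    filter_upwards [this.eventually_eq_zero] with z hz
    exact sub_eq_zero.1 hz
  have heq := aμ.eqOn_of_preconnected_of_eventuallyEq aν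
    ((convex_Ioo (-ε) ε).linear_preimage Complex.reLm).isPreconnected h0 hev
  refine Measure.ext_of_charFun ?_
  ext t
  rw [← complexMGF_id_mul_I, ← complexMGF_id_mul_I]
  exact heq (by simp [hε])

namespace Pr
variable {δ β γ : ℝ} {J : Set ℝ} {f : ℝ → ℝ} {κ τ : ℝ}

theorem complete (H : Pr δ β γ J f κ τ) {w : ℝ → ℝ} (hw : Measurable w)
    (h2 : Integrable (fun x => w x ^ 2 * f x))
    (ho : ∀ k : ℕ, ∫ x, w x * x ^ k * f x = 0) : ∀ᵐ x, w x * f x = 0 := by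
  obtain ⟨ε, hε, hI⟩ := H.exp_moment
  have hexp : ∀ v : ℝ → ℝ, Measurable v → (∀ x, 0 ≤ v x) → (∀ x, v x ≤ |w x|) →
      Integrable (fun x => Real.exp (ε / 2 * |x|) * (v x * f x)) := by
    intro v hv hv0 hvw
    refine (hI.add h2).mono' (by have := H.meas; fun_prop) (ae_of_all _ fun x => ?_)
    have hf := H.nonneg x
    rw [Real.norm_eq_abs, abs_of_nonneg (mul_nonneg (Real.exp_pos _).le (mul_nonneg (hv0 x) hf))]
    have e : Real.exp (ε * |x|) = Real.exp (ε / 2 * |x|) ^ 2 := by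
      rw [← Real.exp_nat_mul]; congr 1; push_cast; ring
    simp only [Pi.add_apply]
    rw [← add_mul, ← mul_assoc, e]
    refine mul_le_mul_of_nonneg_right ?_ hf
    have h3 : Real.exp (ε / 2 * |x|) * v x ≤ Real.exp (ε / 2 * |x|) * |w x| :=
      mul_le_mul_of_nonneg_left (hvw x) (Real.exp_pos _).le
    nlinarith [sq_nonneg (Real.exp (ε / 2 * |x|) - |w x|), sq_abs (w x),
      sq_nonneg (Real.exp (ε / 2 * |x|)), sq_nonneg (w x)]
  set w1 : ℝ → ℝ := fun x => max (w x) 0 with hw1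
  set w2 : ℝ → ℝ := fun x => max (-w x) 0 with hw2
  have m1 : Measurable w1 := hw.max measurable_const
  have m2 : Measurable w2 := hw.neg.max measurable_const
  have p1 : ∀ x, 0 ≤ w1 x := fun x => le_max_right _ _
  have p2 : ∀ x, 0 ≤ w2 x := fun x => le_max_right _ _
  have b1 : ∀ x, w1 x ≤ |w x| := fun x => max_le (le_abs_self _) (abs_nonneg _)
  have b2 : ∀ x, w2 x ≤ |w x| := fun x => max_le (neg_le_abs _) (abs_nonneg _)
  have hsub : ∀ x, w1 x - w2 x = w x := fun x => by
    simp only [hw1, hw2]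
    rcases le_total (w x) 0 with h | h
    · rw [max_eq_right h, max_eq_left (by linarith)]; ring
    · rw [max_eq_left h, max_eq_right (by linarith)]; ring
  have i1 := hexp w1 m1 p1 b1
  have i2 := hexp w2 m2 p2 b2
  -- measures
  have gen : ∀ v : ℝ → ℝ, Measurable v → (∀ x, 0 ≤ v x) →
      Integrable (fun x => Real.exp (ε / 2 * |x|) * (v x * f x)) →
      Integrable (fun x => v x * f x) ∧
      (∀ k : ℕ, Integrable (fun x => v x * x ^ k * f x)) ∧
      Integrable (fun x => Real.exp (ε / 2 * |x|))
        (volume.withDensity fun x => ENNReal.ofReal (v x * f x)) ∧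
      ∀ k : ℕ, ∫ x, x ^ k ∂(volume.withDensity fun x => ENNReal.ofReal (v x * f x)) =
        ∫ x, v x * x ^ k * f x := by
    intro v hv hv0 hi
    have hmf := H.meas
    have hvf : ∀ x, 0 ≤ v x * f x := fun x => mul_nonneg (hv0 x) (H.nonneg x)
    have hmm : Measurable (fun x => ENNReal.ofReal (v x * f x)) := by fun_prop
    have hk : ∀ k : ℕ, Integrable (fun x => v x * x ^ k * f x) := by
      intro k
      refine (hi.const_mul (k.factorial / (ε / 2) ^ k)).mono' (by fun_prop) (ae_of_all _ fun x => ?_)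
      have h1 := Real.pow_div_factorial_le_exp (ε / 2 * |x|) (by positivity) k
      rw [div_le_iff₀ (by positivity), mul_pow] at h1
      have h3 : |x| ^ k ≤ k.factorial / (ε / 2) ^ k * Real.exp (ε / 2 * |x|) := by
        rw [div_mul_eq_mul_div, le_div_iff₀ (by positivity)]; linarith
      have h4 := mul_le_mul_of_nonneg_right h3 (hvf x)
      rw [Real.norm_eq_abs, abs_mul, abs_mul, abs_of_nonneg (hv0 x), abs_of_nonneg (H.nonneg x),
        abs_pow]
      calc _ = |x| ^ k * (v x * f x) := by ring
        _ ≤ _ := h4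
        _ = _ := by ring
    refine ⟨by simpa using hk 0, hk, ?_, ?_⟩
    · rw [integrable_withDensity_iff hmm (ae_of_all _ fun x => ENNReal.ofReal_lt_top)]
      simpa [ENNReal.toReal_ofReal (hvf _)] using hi
    · intro k
      rw [integral_withDensity_eq_integral_toReal_smul hmm
        (ae_of_all _ fun x => ENNReal.ofReal_lt_top)]
      congr 1; ext x
      rw [ENNReal.toReal_ofReal (hvf _), smul_eq_mul]; ring
  obtain ⟨f1, k1, e1, q1⟩ := gen w1 m1 p1 i1
  obtain ⟨f2, k2, e2, q2⟩ := gen w2 m2 p2 i2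
  have F1 : IsFiniteMeasure (volume.withDensity fun x => ENNReal.ofReal (w1 x * f x)) :=
    isFiniteMeasure_withDensity_ofReal f1.2
  have F2 : IsFiniteMeasure (volume.withDensity fun x => ENNReal.ofReal (w2 x * f x)) :=
    isFiniteMeasure_withDensity_ofReal f2.2
  have hE := moment_determinacy (by positivity : 0 < ε / 2) e1 e2 (fun k => by
    rw [q1, q2, ← sub_eq_zero, ← integral_sub (k1 k) (k2 k), ← ho k]
    congr 1; ext x; rw [← hsub x]; ring)
  have hmf := H.meas
  rw [withDensity_eq_iff_of_sigmaFinite (by fun_prop) (by fun_prop)] at hE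
  filter_upwards [hE] with x hx
  have hx' := (ENNReal.ofReal_eq_ofReal_iff (mul_nonneg (p1 x) (H.nonneg x))
    (mul_nonneg (p2 x) (H.nonneg x))).1 hx
  rw [← hsub x, sub_mul, hx', sub_self]

end Pr


namespace Pr
variable {δ β γ : ℝ} {J : Set ℝ} {f : ℝ → ℝ} {κ τ : ℝ}

/-- the first order raising operator -/
def LL (δ β γ κ τ : ℝ) (Q : Polynomial ℝ) : Polynomial ℝ :=
  (Polynomial.C κ * Polynomial.X - Polynomial.C τ) * Q - qP δ β γ * Q.derivative

/-- orthogonal polynomials (Rodrigues) -/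
def phi (δ β γ : ℝ) : ℕ → ℝ → ℝ → Polynomial ℝ
  | 0, _, _ => 1
  | k + 1, κ, τ => LL δ β γ κ τ (phi δ β γ k (κ - 2 * δ) (τ + β))

/-- leading coefficients -/
def lcf (δ : ℝ) : ℕ → ℝ → ℝ
  | 0, _ => 1
  | k + 1, κ => (κ - k * δ) * lcf δ k (κ - 2 * δ)

theorem lcf_eq (k : ℕ) (κ : ℝ) : lcf δ k κ = ∏ j ∈ range k, (κ - ((k : ℝ) - 1 + j) * δ) := by
  induction k generalizing κ with
  | zero => simp [lcf]
  | succ k ih =>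
    rw [lcf, ih, prod_range_succ', mul_comm]
    congr 1
    · refine prod_congr rfl fun j _ => ?_
      push_cast; ring
    · push_cast; ring

theorem lcf_pos (hδ : δ ≤ 0) (k : ℕ) {κ : ℝ} (hκ : 0 < κ) : 0 < lcf δ k κ := by
  induction k generalizing κ with
  | zero => simp [lcf]
  | succ k ih =>
    rw [lcf]
    have : (k : ℝ) * δ ≤ 0 := mul_nonpos_of_nonneg_of_nonpos (by positivity) hδ
    exact mul_pos (by linarith) (ih (by linarith))

theorem qP_natDegree : (qP δ β γ).natDegree ≤ 2 := by
  unfold qP; compute_degree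

theorem phi_natDegree (k : ℕ) (κ τ : ℝ) : (phi δ β γ k κ τ).natDegree ≤ k := by
  induction k generalizing κ τ with
  | zero => simp [phi]
  | succ k ih =>
    rw [phi, LL]
    have h := ih (κ - 2 * δ) (τ + β)
    refine (Polynomial.natDegree_sub_le _ _).trans (max_le ?_ ?_)
    · refine Polynomial.natDegree_mul_le.trans ?_
      have : (Polynomial.C κ * Polynomial.X - Polynomial.C τ).natDegree ≤ 1 := by compute_degree
      omega
    · by_cases hd : (phi δ β γ k (κ - 2 * δ) (τ + β)).natDegree = 0
      · rw [Polynomial.derivative_of_natDegree_zero hd]; simp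
      · refine Polynomial.natDegree_mul_le.trans ?_
        have h1 := Polynomial.natDegree_derivative_lt hd
        have h2 := qP_natDegree (δ := δ) (β := β) (γ := γ)
        omega

theorem phi_coeff (k : ℕ) (κ τ : ℝ) : (phi δ β γ k κ τ).coeff k = lcf δ k κ := by
  induction k generalizing κ τ with
  | zero => simp [phi, lcf]
  | succ k ih =>
    rw [phi, LL, lcf, ← ih (κ - 2 * δ) (τ + β)]
    have h := phi_natDegree (δ := δ) (β := β) (γ := γ) k (κ - 2 * δ) (τ + β)
    set Q := phi δ β γ k (κ - 2 * δ) (τ + β)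
    have z1 : Q.coeff (k + 1) = 0 := Polynomial.coeff_eq_zero_of_natDegree_lt (by omega)
    have z2 : Q.coeff (k + 2) = 0 := Polynomial.coeff_eq_zero_of_natDegree_lt (by omega)
    have e : qP δ β γ * Q.derivative = Polynomial.C δ * (Q.derivative * Polynomial.X ^ 2) +
      Polynomial.C β * (Q.derivative * Polynomial.X) + Polynomial.C γ * Q.derivative := by
      rw [qP]; ring
    have e2 : (Polynomial.C κ * Polynomial.X - Polynomial.C τ) * Q =
      Polynomial.C κ * (Q * Polynomial.X) - Polynomial.C τ * Q := by ring
    rw [e, e2]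
    simp only [Polynomial.coeff_sub, Polynomial.coeff_add, Polynomial.coeff_C_mul,
      Polynomial.coeff_mul_X, Polynomial.coeff_derivative, z1, z2]
    have e3 : (Q.derivative * Polynomial.X ^ 2).coeff (k + 1) = k * Q.coeff k := by
      rcases k with _ | j
      · rw [Polynomial.coeff_mul_X_pow']; simp
      · rw [show j + 1 + 1 = j + 2 from rfl, Polynomial.coeff_mul_X_pow,
          Polynomial.coeff_derivative]
        push_cast; ring
    rw [e3]; ring

theorem pair (H : Pr δ β γ J f κ τ) (i : ℕ) (gs : ℕ → ℝ → ℝ)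
    (hW : ∀ r < i, WD J (gs r) (gs (r + 1)))
    (hi : Integrable (fun x => pq δ β γ x ^ i * gs i x * f x)) :
    (∀ k ≤ i, Integrable (fun x => x ^ k * (gs 0 x * f x))) ∧
    ∫ x, gs 0 x * (phi δ β γ i κ τ).eval x * f x = ∫ x, pq δ β γ x ^ i * gs i x * f x := by
  induction i generalizing f κ τ gs with
  | zero =>
    refine ⟨fun k hk => ?_, ?_⟩
    · obtain rfl : k = 0 := by omega
      simpa using hi
    · simp [phi]
  | succ i ih =>
    have e : (fun x => pq δ β γ x ^ i * gs (i + 1) x * (pq δ β γ x * f x)) =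
        (fun x => pq δ β γ x ^ (i + 1) * gs (i + 1) x * f x) := by ext x; ring
    obtain ⟨h1, h2⟩ := ih H.step (fun r => gs (r + 1)) (fun r hr => hW (r + 1) (by omega))
      (by rw [e]; exact hi)
    rw [e] at h2
    refine ⟨H.stein_int (hW 0 (by omega)) i h1, ?_⟩
    rw [← h2]
    have h3 := H.stein_poly (hW 0 (by omega)) i h1 (phi δ β γ i (κ - 2 * δ) (τ + β))
      (phi_natDegree _ _ _)
    simp only [zero_add] at h3 ⊢
    rw [← h3]
    congr 1; ext x
    rw [phi, LL]
    simp [qP_eval]; ring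

theorem pair_poly (H : Pr δ β γ J f κ τ) (i : ℕ) (p : Polynomial ℝ) :
    ∫ x, p.eval x * (phi δ β γ i κ τ).eval x * f x =
      ∫ x, pq δ β γ x ^ i * (Polynomial.derivative^[i] p).eval x * f x := by
  refine (H.pair i (fun r x => (Polynomial.derivative^[r] p).eval x) (fun r _ => ?_) ?_).2
  · refine wd_of_deriv J (fun x => ?_) (Polynomial.continuous _)
    rw [Function.iterate_succ_apply']
    exact Polynomial.hasDerivAt _ x
  · refine (H.int_poly' (qP δ β γ ^ i * (Polynomial.derivative^[i] p))).congr
      (ae_of_all _ fun x => ?_)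
    simp [qP_eval]

theorem pair_low (H : Pr δ β γ J f κ τ) {i : ℕ} {p : Polynomial ℝ} (hp : p.natDegree < i) :
    ∫ x, p.eval x * (phi δ β γ i κ τ).eval x * f x = 0 := by
  rw [H.pair_poly, Polynomial.iterate_derivative_eq_zero hp]; simp

/-- norming constants -/
def NN (δ β γ : ℝ) (f : ℝ → ℝ) (κ τ : ℝ) (k : ℕ) : ℝ := ∫ x, (phi δ β γ k κ τ).eval x ^ 2 * f x

theorem NN_eq (H : Pr δ β γ J f κ τ) (k : ℕ) : NN δ β γ f κ τ k =
    lcf δ k κ * k.factorial * ∫ x, pq δ β γ x ^ k * f x := by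
  have h := H.pair_poly k (phi δ β γ k κ τ)
  have hd : Polynomial.derivative^[k] (phi δ β γ k κ τ) =
      Polynomial.C (lcf δ k κ * k.factorial) := by
    rw [Polynomial.eq_C_of_natDegree_eq_zero (p := Polynomial.derivative^[k] (phi δ β γ k κ τ))]
    · rw [Polynomial.coeff_iterate_derivative, zero_add, phi_coeff, Nat.descFactorial_self]
      simp [mul_comm]
    · have h1 := Polynomial.natDegree_iterate_derivative (phi δ β γ k κ τ) k
      have h2 := phi_natDegree (δ := δ) (β := β) (γ := γ) k κ τ
      omega
  rw [hd] at h
  rw [NN, ← integral_const_mul]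
  simp only [Polynomial.eval_C] at h
  calc _ = ∫ x, (phi δ β γ k κ τ).eval x * (phi δ β γ k κ τ).eval x * f x := by
        congr 1; ext x; ring
    _ = _ := h
    _ = _ := by congr 1; ext x; ring

theorem int_qpow_pos (H : Pr δ β γ J f κ τ) (k : ℕ) : 0 < ∫ x, pq δ β γ x ^ k * f x := by
  have hi : Integrable (fun x => pq δ β γ x ^ k * f x) := by
    refine (H.int_poly' (qP δ β γ ^ k)).congr (ae_of_all _ fun x => ?_)
    simp [qP_eval]
  rw [integral_pos_iff_support_of_nonneg (fun x => ?_) hi]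
  · refine lt_of_lt_of_le (H.isOpen.measure_pos volume ⟨_, H.c_mem⟩) (measure_mono fun x hx => ?_)
    exact (mul_pos (pow_pos (H.qpos x hx) k) (H.pos_on hx)).ne'
  · by_cases hx : x ∈ J
    · exact (mul_pos (pow_pos (H.qpos x hx) k) (H.pos_on hx)).le
    · simp [H.zero_off hx]

theorem NN_pos (H : Pr δ β γ J f κ τ) (k : ℕ) : 0 < NN δ β γ f κ τ k := by
  rw [H.NN_eq]
  exact mul_pos (mul_pos (lcf_pos H.hδ k H.hκ) (by positivity)) (H.int_qpow_pos k)

theorem NN_succ (H : Pr δ β γ J f κ τ) (k : ℕ) : NN δ β γ f κ τ (k + 1) =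
    (k + 1) * (κ - k * δ) * NN δ β γ (fun x => pq δ β γ x * f x) (κ - 2 * δ) (τ + β) k := by
  rw [H.NN_eq, H.step.NN_eq, lcf, Nat.factorial_succ]
  have : (fun x => pq δ β γ x ^ k * (pq δ β γ x * f x)) =
    fun x => pq δ β γ x ^ (k + 1) * f x := by ext x; ring
  rw [this]; push_cast; ring

end Pr


namespace Pr
variable {δ β γ : ℝ} {J : Set ℝ} {f : ℝ → ℝ} {κ τ : ℝ}

/-- square integrable functions with respect to `f` -/
def L2 (J : Set ℝ) (f g : ℝ → ℝ) : Prop :=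
  AEStronglyMeasurable g (volume.restrict J) ∧ Integrable (fun x => g x ^ 2 * f x)

theorem L2_poly (H : Pr δ β γ J f κ τ) (p : Polynomial ℝ) : L2 J f (fun x => p.eval x) :=
  ⟨H.cont_aesm p.continuous.continuousOn, by
    refine (H.int_poly' (p ^ 2)).congr (ae_of_all _ fun x => ?_)
    simp⟩

theorem L2_mul (H : Pr δ β γ J f κ τ) {u v : ℝ → ℝ} (hu : L2 J f u) (hv : L2 J f v) :
    Integrable (fun x => u x * v x * f x) := by
  refine H.int_mono (g := fun x => u x * v x) (k := fun x => u x ^ 2 + v x ^ 2)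
    (hu.1.mul hv.1) ?_ ?_
  · refine (hu.2.add hv.2).congr (ae_of_all _ fun x => ?_)
    simp only [Pi.add_apply]; ring
  · intro x _
    rw [abs_mul]
    nlinarith [sq_nonneg (|u x| - |v x|), sq_abs (u x), sq_abs (v x), sq_nonneg (u x),
      sq_nonneg (v x)]

theorem L2_mul_poly (H : Pr δ β γ J f κ τ) {u : ℝ → ℝ} (hu : L2 J f u) (p : Polynomial ℝ) :
    Integrable (fun x => u x * p.eval x * f x) := H.L2_mul hu (H.L2_poly p)

theorem span_all (H : Pr δ β γ J f κ τ) {u : ℝ → ℝ} (hu : L2 J f u) (n : ℕ)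
    (h0 : ∀ k, k ≤ n → ∫ x, u x * (phi δ β γ k κ τ).eval x * f x = 0) :
    ∀ p : Polynomial ℝ, p.natDegree ≤ n → ∫ x, u x * p.eval x * f x = 0 := by
  induction n with
  | zero =>
    intro p hp
    have h1 := h0 0 le_rfl
    rw [Polynomial.eq_C_of_natDegree_le_zero hp]
    simp only [phi, Polynomial.eval_one, Polynomial.eval_C] at h1 ⊢
    calc _ = p.coeff 0 * ∫ x, u x * 1 * f x := by
          rw [← integral_const_mul]; congr 1; ext x; ring
      _ = 0 := by rw [h1, mul_zero]
  | succ n ih =>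
    intro p hp
    have hl := lcf_pos H.hδ (n + 1) H.hκ
    set a := p.coeff (n + 1) / lcf δ (n + 1) κ with ha
    set r := p - Polynomial.C a * phi δ β γ (n + 1) κ τ with hr
    have hrd : r.natDegree ≤ n := by
      have h1 : r.natDegree ≤ n + 1 := by
        refine (Polynomial.natDegree_sub_le _ _).trans (max_le hp ?_)
        exact (Polynomial.natDegree_C_mul_le _ _).trans (phi_natDegree _ _ _)
      have h2 : r.coeff (n + 1) = 0 := by
        rw [hr, Polynomial.coeff_sub, Polynomial.coeff_C_mul, phi_coeff, ha]
        field_simp; ring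
      by_contra hlt
      have h3 : r.natDegree = n + 1 := by omega
      have h4 : r.leadingCoeff = 0 := by rw [Polynomial.leadingCoeff, h3, h2]
      rw [Polynomial.leadingCoeff_eq_zero] at h4
      rw [h4] at h3; simp at h3
    have h5 := ih (fun k hk => h0 k (by omega)) r hrd
    have h6 := h0 (n + 1) le_rfl
    have e : (fun x => u x * p.eval x * f x) = fun x => u x * r.eval x * f x +
        a * (u x * (phi δ β γ (n + 1) κ τ).eval x * f x) := by
      ext x; simp [hr]; ring
    rw [e, integral_add (H.L2_mul_poly hu r) ((H.L2_mul_poly hu _).const_mul a),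
      integral_const_mul, h5, h6]; simp

theorem ortho (H : Pr δ β γ J f κ τ) {i j : ℕ} (hij : i ≠ j) :
    ∫ x, (phi δ β γ i κ τ).eval x * (phi δ β γ j κ τ).eval x * f x = 0 := by
  rcases lt_or_gt_of_ne hij with h | h
  · exact H.pair_low (lt_of_le_of_lt (phi_natDegree _ _ _) h)
  · simp_rw [mul_comm (Polynomial.eval _ (phi δ β γ i κ τ))]
    exact H.pair_low (lt_of_le_of_lt (phi_natDegree _ _ _) h)

/-- the weighted measure -/
def nu (f : ℝ → ℝ) : Measure ℝ := volume.withDensity (fun x => ENNReal.ofReal (f x))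

theorem nu_int (H : Pr δ β γ J f κ τ) (u : ℝ → ℝ) : ∫ x, u x ∂(nu f) = ∫ x, u x * f x := by
  have := H.meas
  rw [nu, integral_withDensity_eq_integral_toReal_smul (by fun_prop)
    (ae_of_all _ fun x => ENNReal.ofReal_lt_top)]
  congr 1; ext x; rw [ENNReal.toReal_ofReal (H.nonneg x), smul_eq_mul, mul_comm]

theorem nu_integrable (H : Pr δ β γ J f κ τ) (u : ℝ → ℝ) :
    Integrable u (nu f) ↔ Integrable (fun x => u x * f x) := by
  have := H.meas
  rw [nu, integrable_withDensity_iff (by fun_prop) (ae_of_all _ fun x => ENNReal.ofReal_lt_top)]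
  simp only [ENNReal.toReal_ofReal (H.nonneg _)]

theorem nu_ae (H : Pr δ β γ J f κ τ) {p : ℝ → Prop} :
    (∀ᵐ x ∂(nu f), p x) ↔ ∀ᵐ x ∂(volume.restrict J), p x := by
  have := H.meas
  rw [nu, ae_withDensity_iff (by fun_prop), ae_restrict_iff' H.isOpen.measurableSet]
  refine eventually_congr (ae_of_all _ fun x => ?_)
  have : ENNReal.ofReal (f x) ≠ 0 ↔ x ∈ J := by
    rw [H.hJ]; simp
  rw [this]

theorem nu_aesm (H : Pr δ β γ J f κ τ) {u : ℝ → ℝ}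
    (hu : AEStronglyMeasurable u (volume.restrict J)) : AEStronglyMeasurable u (nu f) :=
  ⟨hu.mk u, hu.stronglyMeasurable_mk, H.nu_ae.2 hu.ae_eq_mk⟩

theorem nu_aesm_iff (H : Pr δ β γ J f κ τ) {u : ℝ → ℝ} :
    AEStronglyMeasurable u (volume.restrict J) ↔ AEStronglyMeasurable u (nu f) :=
  ⟨H.nu_aesm, fun hu => ⟨hu.mk u, hu.stronglyMeasurable_mk, H.nu_ae.1 hu.ae_eq_mk⟩⟩

theorem L2_memLp (H : Pr δ β γ J f κ τ) {u : ℝ → ℝ} : L2 J f u ↔ MemLp u 2 (nu f) := by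
  constructor
  · intro hu
    rw [memLp_two_iff_integrable_sq (H.nu_aesm hu.1), H.nu_integrable]
    exact hu.2
  · intro hu
    refine ⟨H.nu_aesm_iff.2 hu.1, ?_⟩
    rw [memLp_two_iff_integrable_sq hu.1, H.nu_integrable] at hu
    exact hu

theorem inner_toLp (H : Pr δ β γ J f κ τ) {u v : ℝ → ℝ} (hu : MemLp u 2 (nu f))
    (hv : MemLp v 2 (nu f)) : inner ℝ (hu.toLp u) (hv.toLp v) = ∫ x, u x * v x * f x := by
  rw [L2.inner_def, ← H.nu_int (fun x => u x * v x)]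
  refine integral_congr_ae ?_
  filter_upwards [hu.coeFn_toLp, hv.coeFn_toLp] with x h1 h2
  rw [h1, h2]; simp [mul_comm]

theorem zero_of_ortho (H : Pr δ β γ J f κ τ) {u : ℝ → ℝ} (hu : L2 J f u)
    (h0 : ∀ k, ∫ x, u x * (phi δ β γ k κ τ).eval x * f x = 0) :
    ∀ᵐ x ∂(volume.restrict J), u x = 0 := by
  have hp : ∀ p : Polynomial ℝ, ∫ x, u x * p.eval x * f x = 0 := fun p =>
    H.span_all hu p.natDegree (fun k _ => h0 k) p le_rfl
  set w := hu.1.mk u with hw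
  have hae : ∀ᵐ x, u x * f x = w x * f x := by
    have h1 := (ae_restrict_iff' H.isOpen.measurableSet).1 hu.1.ae_eq_mk
    filter_upwards [h1] with x hx
    by_cases hxJ : x ∈ J
    · rw [hx hxJ]
    · simp [H.zero_off hxJ]
  have hae2 : ∀ᵐ x, u x = w x ∨ f x = 0 := by
    filter_upwards [hae] with x hx
    exact mul_eq_mul_right_iff.1 hx
  have hc := H.complete (w := w) hu.1.stronglyMeasurable_mk.measurable (by
      refine hu.2.congr ?_
      filter_upwards [hae2] with x hx
      rcases hx with hx | hx <;> simp [hx]) (fun k => by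
      rw [← hp (Polynomial.X ^ k)]
      refine integral_congr_ae ?_
      filter_upwards [hae2] with x hx
      rcases hx with hx | hx <;> simp [hx])
  rw [ae_restrict_iff' H.isOpen.measurableSet]
  filter_upwards [hc, hae] with x h1 h2 hx
  rw [← h2] at h1
  exact (mul_eq_zero.1 h1).resolve_right (H.pos_on hx).ne'

/-- squared Fourier coefficients -/
def CC (δ β γ : ℝ) (f : ℝ → ℝ) (κ τ : ℝ) (g : ℝ → ℝ) (k : ℕ) : ℝ :=
  (∫ x, g x * (phi δ β γ k κ τ).eval x * f x) ^ 2 / NN δ β γ f κ τ k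

theorem parseval (H : Pr δ β γ J f κ τ) {g : ℝ → ℝ} (hg : L2 J f g) :
    HasSum (CC δ β γ f κ τ g) (∫ x, g x ^ 2 * f x) := by
  set e : ℕ → ℝ → ℝ := fun k x =>
    (Polynomial.C (Real.sqrt (NN δ β γ f κ τ k))⁻¹ * phi δ β γ k κ τ).eval x with he
  have hN := H.NN_pos
  have hm : ∀ k, MemLp (e k) 2 (nu f) := fun k => H.L2_memLp.1 (H.L2_poly _)
  have hev : ∀ k x, e k x = (Real.sqrt (NN δ β γ f κ τ k))⁻¹ * (phi δ β γ k κ τ).eval x := by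
    intro k x; simp [he]
  set E : ℕ → Lp ℝ 2 (nu f) := fun k => (hm k).toLp (e k) with hE
  have hon : Orthonormal ℝ E := by
    rw [orthonormal_iff_ite]
    intro i j
    rw [hE, H.inner_toLp]
    have e1 : (fun x => e i x * e j x * f x) = fun x =>
      ((Real.sqrt (NN δ β γ f κ τ i))⁻¹ * (Real.sqrt (NN δ β γ f κ τ j))⁻¹) *
        ((phi δ β γ i κ τ).eval x * (phi δ β γ j κ τ).eval x * f x) := by
      ext x; rw [hev, hev]; ring
    rw [e1, integral_const_mul]
    split_ifs with h
    · subst h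
      have : (∫ x, (phi δ β γ i κ τ).eval x * (phi δ β γ i κ τ).eval x * f x) =
        NN δ β γ f κ τ i := by rw [NN]; congr 1; ext x; ring
      rw [this, ← mul_inv, Real.mul_self_sqrt (hN i).le]
      exact inv_mul_cancel₀ (hN i).ne'
    · rw [H.ortho h, mul_zero]
  have hbot : (Submodule.span ℝ (Set.range E))ᗮ = ⊥ := by
    rw [Submodule.eq_bot_iff]
    intro w hw
    rw [Submodule.mem_orthogonal] at hw
    have hwL : L2 J f w := H.L2_memLp.2 (Lp.memLp w)
    have h0 : ∀ k, ∫ x, w x * (phi δ β γ k κ τ).eval x * f x = 0 := by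
      intro k
      have h1 := hw (E k) (Submodule.subset_span ⟨k, rfl⟩)
      rw [← Lp.toLp_coeFn w (Lp.memLp w), hE, H.inner_toLp] at h1
      have e1 : (fun x => e k x * w x * f x) = fun x => (Real.sqrt (NN δ β γ f κ τ k))⁻¹ *
        (w x * (phi δ β γ k κ τ).eval x * f x) := by
        ext x; rw [hev]; ring
      rw [e1, integral_const_mul] at h1
      refine (mul_eq_zero.1 h1).resolve_left ?_
      have := hN k
      positivity
    have h2 := H.nu_ae.2 (H.zero_of_ortho hwL h0)
    exact (Lp.eq_zero_iff_ae_eq_zero).2 h2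
  set b := HilbertBasis.mkOfOrthogonalEqBot hon hbot with hb
  have hgm := H.L2_memLp.1 hg
  have hs := b.hasSum_inner_mul_inner (hgm.toLp g) (hgm.toLp g)
  rw [H.inner_toLp] at hs
  have hbk : ∀ k, b k = E k := fun k => by
    rw [hb, HilbertBasis.coe_mkOfOrthogonalEqBot]
  simp_rw [hbk] at hs
  have e2 : ∀ k, inner ℝ (hgm.toLp g) (E k) * inner ℝ (E k) (hgm.toLp g) =
      CC δ β γ f κ τ g k := by
    intro k
    rw [real_inner_comm (hgm.toLp g) (E k), hE, H.inner_toLp]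
    have e1 : (fun x => g x * e k x * f x) = fun x => (Real.sqrt (NN δ β γ f κ τ k))⁻¹ *
        (g x * (phi δ β γ k κ τ).eval x * f x) := by
        ext x; rw [hev]; ring
    rw [e1, integral_const_mul, CC]
    have h3 := Real.mul_self_sqrt (hN k).le
    set s := Real.sqrt (NN δ β γ f κ τ k)
    rw [← h3, div_eq_mul_inv, mul_inv]; ring
  simp_rw [e2] at hs
  have e3 : (fun x => g x * g x * f x) = fun x => g x ^ 2 * f x := by ext x; ring
  rw [e3] at hs
  exact hs

end Pr


namespace Pr
variable {δ β γ : ℝ} {J : Set ℝ} {f : ℝ → ℝ} {κ τ : ℝ}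

/-- eigenvalue products -/
def Lam (δ : ℝ) : ℕ → ℝ → ℕ → ℝ
  | 0, _, _ => 1
  | _ + 1, _, 0 => 0
  | i + 1, κ, k + 1 => (k + 1) * (κ - k * δ) * Lam δ i (κ - 2 * δ) k

theorem Lam_eq (i : ℕ) (κ : ℝ) (k : ℕ) :
    Lam δ i κ k = ∏ r ∈ range i, (((k : ℝ) - r) * (κ - ((k : ℝ) - 1 + r) * δ)) := by
  induction i generalizing κ k with
  | zero => simp [Lam]
  | succ i ih =>
    rw [prod_range_succ']
    rcases k with _ | k
    · simp [Lam]
    · rw [Lam, ih, mul_comm]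
      congr 1
      · refine prod_congr rfl fun r _ => ?_
        push_cast; ring
      · push_cast; ring

theorem CC_succ (H : Pr δ β γ J f κ τ) {g h : ℝ → ℝ} (hW : WD J g h)
    (hh : L2 J (fun x => pq δ β γ x * f x) h) (k : ℕ) :
    CC δ β γ (fun x => pq δ β γ x * f x) (κ - 2 * δ) (τ + β) h k =
      (k + 1) * (κ - k * δ) * CC δ β γ f κ τ g (k + 1) := by
  have h1 : ∫ x, g x * (phi δ β γ (k + 1) κ τ).eval x * f x =
      ∫ x, h x * (phi δ β γ k (κ - 2 * δ) (τ + β)).eval x * (pq δ β γ x * f x) := by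
    rw [← H.stein_poly hW k (fun j _ => by
      refine (H.step.L2_mul_poly hh (Polynomial.X ^ j)).congr (ae_of_all _ fun x => ?_)
      simp; ring) _ (phi_natDegree _ _ _)]
    congr 1; ext x
    rw [phi, LL]
    simp [qP_eval]; ring
  rw [CC, CC, h1, H.NN_succ]
  have h2 := (H.step.NN_pos k).ne'
  have h3 : (κ - k * δ) ≠ 0 := by
    have : (k : ℝ) * δ ≤ 0 := mul_nonpos_of_nonneg_of_nonpos (by positivity) H.hδ
    have := H.hκ
    linarith
  have h4 : (k : ℝ) + 1 ≠ 0 := by positivity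
  generalize κ - k * δ = s at h3
  field_simp

theorem iter (H : Pr δ β γ J f κ τ) (i : ℕ) (gs : ℕ → ℝ → ℝ)
    (hW : ∀ r < i, WD J (gs r) (gs (r + 1)))
    (hm : AEStronglyMeasurable (gs i) (volume.restrict J))
    (hi : Integrable (fun x => pq δ β γ x ^ i * gs i x ^ 2 * f x)) :
    L2 J f (gs 0) ∧ HasSum (fun k => Lam δ i κ k * CC δ β γ f κ τ (gs 0) k)
      (∫ x, pq δ β γ x ^ i * gs i x ^ 2 * f x) := by
  induction i generalizing f κ τ gs with
  | zero =>
    have h : L2 J f (gs 0) := ⟨hm, by simpa using hi⟩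
    refine ⟨h, ?_⟩
    simpa [Lam] using H.parseval h
  | succ i ih =>
    have e : (fun x => pq δ β γ x ^ i * gs (i + 1) x ^ 2 * (pq δ β γ x * f x)) =
        (fun x => pq δ β γ x ^ (i + 1) * gs (i + 1) x ^ 2 * f x) := by ext x; ring
    obtain ⟨h1, h2⟩ := ih H.step (fun r => gs (r + 1)) (fun r hr => hW (r + 1) (by omega)) hm
      (by rw [e]; exact hi)
    rw [e] at h2
    simp only [zero_add] at h1 h2
    have hW0 := hW 0 (by omega)
    refine ⟨⟨H.cont_aesm (hW0.contOn H.conn H.isOpen), H.poincare hW0 h1.2⟩, ?_⟩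
    rw [← hasSum_nat_add_iff' 1]
    simp only [sum_range_one, Lam, zero_mul, sub_zero]
    refine h2.congr_fun ?_
    intro k
    rw [H.CC_succ hW0 h1]; ring

theorem stepN (H : Pr δ β γ J f κ τ) (i : ℕ) :
    ∃ κ' τ' : ℝ, Pr δ β γ J (fun x => pq δ β γ x ^ i * f x) κ' τ' := by
  induction i with
  | zero => exact ⟨κ, τ, by simpa using H⟩
  | succ i ih =>
    obtain ⟨κ', τ', h⟩ := ih
    · have := h.step
      have e : (fun x => pq δ β γ x ^ (i + 1) * f x) =
        (fun x => pq δ β γ x * (pq δ β γ x ^ i * f x)) := by ext x; ring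
      rw [e]; exact ⟨_, _, this⟩

theorem L2_low (H : Pr δ β γ J f κ τ) (n : ℕ) (gs : ℕ → ℝ → ℝ)
    (hW : ∀ r < n, WD J (gs r) (gs (r + 1)))
    (hm : AEStronglyMeasurable (gs n) (volume.restrict J))
    (hi : Integrable (fun x => pq δ β γ x ^ n * gs n x ^ 2 * f x)) (i : ℕ) (hin : i ≤ n) :
    AEStronglyMeasurable (gs i) (volume.restrict J) ∧
    Integrable (fun x => pq δ β γ x ^ i * gs i x ^ 2 * f x) ∧
    Integrable (fun x => pq δ β γ x ^ i * gs i x * f x) := by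
  obtain ⟨κ', τ', h⟩ := H.stepN i
  obtain ⟨d, rfl⟩ := Nat.exists_eq_add_of_le hin
  have h1 := (h.iter d (fun r => gs (i + r)) (fun r hr => hW (i + r) (by omega)) hm (by
    refine hi.congr (ae_of_all _ fun x => ?_)
    simp only; ring)).1
  simp only [add_zero] at h1
  refine ⟨h1.1, h1.2.congr (ae_of_all _ fun x => ?_), ?_⟩
  · simp only; ring
  · refine (h.L2_mul_poly h1 1).congr (ae_of_all _ fun x => ?_)
    simp; ring

end Pr


theorem pp_pos {δ a : ℝ} (hδ : δ ≤ 0) (ha : 0 ≤ a) (n : ℕ) : 0 < pp δ a n :=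
  prod_pos fun j _ => by
    have : (a + j) * δ ≤ 0 := mul_nonpos_of_nonneg_of_nonpos (by positivity) hδ
    linarith

/-- eigenvalues -/
def lam (δ t : ℝ) : ℝ := t * (1 - (t - 1) * δ)

theorem lam_sub (δ s t : ℝ) : lam δ t - lam δ s = (t - s) * (1 - (t - 1 + s) * δ) := by
  unfold lam; ring

theorem lam_pos {δ a : ℝ} (hδ : δ ≤ 0) (ha : 0 ≤ a) : 0 < lam δ (a + 1) := by
  unfold lam
  have : a * δ ≤ 0 := mul_nonpos_of_nonneg_of_nonpos ha hδ
  exact mul_pos (by linarith) (by linarith)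

/-- the coefficients b -/
def bb (δ a : ℝ) (n i : ℕ) : ℝ := (n.choose i : ℝ) / (fall (a + n) i * pp δ a i)

theorem pp_succ' (δ a : ℝ) (i : ℕ) : pp δ a (i + 1) = (1 - a * δ) * pp δ (a + 1) i := by
  unfold pp
  rw [prod_range_succ', mul_comm]
  congr 1
  · simp
  · refine prod_congr rfl fun j _ => ?_
    push_cast; ring

theorem fall_ne {x : ℝ} {i : ℕ} (h : (i : ℝ) < x + 1) : fall x i ≠ 0 := by
  unfold fall
  rw [prod_ne_zero_iff]
  intro j hj
  have h1 : (j : ℝ) + 1 ≤ i := by exact_mod_cast (mem_range.1 hj)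
  have : 0 < x - j := by linarith
  exact this.ne'

theorem bb_rec {δ a : ℝ} (hδ : δ ≤ 0) (ha : 0 ≤ a) (n i : ℕ) (hi : i ≤ n) :
    bb δ (a + 1) n (i + 1) * (lam δ (a + 1) - lam δ ((i : ℝ) + 1)) + bb δ (a + 1) n i =
      lam δ (a + 1) * bb δ a (n + 1) (i + 1) := by
  have hin : (i : ℝ) ≤ n := by exact_mod_cast hi
  rw [lam_sub]
  unfold bb
  have e1 : a + 1 + (n : ℝ) = a + ((n + 1 : ℕ) : ℝ) := by push_cast; ring
  rw [e1]
  set M : ℝ := a + ((n + 1 : ℕ) : ℝ) with hM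
  have hM' : M = a + n + 1 := by rw [hM]; push_cast; ring
  have f1 : fall M (i + 1) = fall M i * (M - i) := by unfold fall; rw [prod_range_succ]
  have f0 : fall M i ≠ 0 := fall_ne (by rw [hM']; linarith)
  have f2 : M - i ≠ 0 := by
    have : 0 < M - i := by rw [hM']; linarith
    exact this.ne'
  have p1 : pp δ (a + 1) (i + 1) = pp δ (a + 1) i * (1 - (a + 1 + i) * δ) := by
    unfold pp; rw [prod_range_succ]
  have p0 := (pp_pos hδ (by linarith : 0 ≤ a + 1) i).ne'
  have hai : 1 - (a + 1 + i) * δ ≠ 0 := by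
    have : (a + 1 + i) * δ ≤ 0 := mul_nonpos_of_nonneg_of_nonpos (by positivity) hδ
    linarith
  have ha0 : 1 - a * δ ≠ 0 := by
    have : a * δ ≤ 0 := mul_nonpos_of_nonneg_of_nonpos ha hδ
    linarith
  have hch : ((n + 1).choose (i + 1) : ℝ) = n.choose i + n.choose (i + 1) := by
    rw [Nat.choose_succ_succ]; push_cast; ring
  have hch2 : (n.choose (i + 1) : ℝ) * (i + 1) = n.choose i * (n - i) := by
    have := Nat.choose_succ_right_eq n i
    have h2 := congrArg (fun t : ℕ => (t : ℝ)) this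
    push_cast [Nat.cast_sub hi] at h2
    exact h2
  rw [f1, p1, pp_succ', hch, lam]
  have e2 : (1 - (a + 1 - 1 + ((i : ℝ) + 1)) * δ) = 1 - (a + 1 + i) * δ := by ring
  have e3 : (1 - (a + 1 - 1) * δ) = 1 - a * δ := by ring
  rw [e2, e3]
  field_simp
  rw [hM']
  linear_combination -hch2

theorem Tsum {δ a : ℝ} (hδ : δ ≤ 0) (ha : 0 ≤ a) (n : ℕ) (L : ℝ) :
    ∑ i ∈ range (n + 1), (-1) ^ i * bb δ a n i * ∏ r ∈ range i, (L - lam δ r) =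
      ∏ j ∈ range n, (1 - L / lam δ (a + j + 1)) := by
  induction n generalizing a with
  | zero => simp [bb, fall, pp]
  | succ n ih =>
    have ih' := ih (by linarith : 0 ≤ a + 1)
    have hl := lam_pos hδ ha
    rw [prod_range_succ']
    have e : ∏ j ∈ range n, (1 - L / lam δ (a + ((j + 1 : ℕ) : ℝ) + 1)) =
        ∏ j ∈ range n, (1 - L / lam δ (a + 1 + j + 1)) :=
      prod_congr rfl fun j _ => by push_cast; ring_nf
    rw [e, ← ih']
    have e0 : lam δ (a + ((0 : ℕ) : ℝ) + 1) = lam δ (a + 1) := by simp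
    rw [e0]
    set l := lam δ (a + 1) with hldef
    set Pi : ℕ → ℝ := fun i => ∏ r ∈ range i, (L - lam δ r) with hPi
    have hPs : ∀ i : ℕ, Pi (i + 1) = Pi i * (L - lam δ i) := fun i => by
      simp only [hPi]; rw [prod_range_succ]
    have b0 : ∀ (a : ℝ) (n : ℕ), bb δ a n 0 = 1 := fun a n => by simp [bb, fall, pp]
    have hlast : bb δ (a + 1) n (n + 1) = 0 := by simp [bb]
    have hl0 : lam δ ((0 : ℕ) : ℝ) = 0 := by simp [lam]
    have P0 : Pi 0 = 1 := by simp [hPi]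
    -- multiply by l
    rw [← mul_left_cancel_iff_of_pos hl]
    have A : ∑ i ∈ range (n + 1), (-1) ^ i * bb δ (a + 1) n i * (l - lam δ i) * Pi i =
        l + ∑ i ∈ range (n + 1), (-1) ^ (i + 1) * bb δ (a + 1) n (i + 1) *
          (l - lam δ ((i : ℝ) + 1)) * Pi (i + 1) := by
      have h1 : ∑ i ∈ range (n + 1 + 1), (-1) ^ i * bb δ (a + 1) n i * (l - lam δ i) * Pi i =
        ∑ i ∈ range (n + 1), (-1) ^ i * bb δ (a + 1) n i * (l - lam δ i) * Pi i := by
        rw [sum_range_succ, hlast]; simp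
      rw [← h1, sum_range_succ', b0, hl0, P0, add_comm]
      push_cast
      ring_nf
    calc l * ∑ i ∈ range (n + 1 + 1), (-1) ^ i * bb δ a (n + 1) i * Pi i
        = l + ∑ i ∈ range (n + 1), (-1) ^ (i + 1) * (l * bb δ a (n + 1) (i + 1)) * Pi (i + 1) := by
          rw [sum_range_succ', b0, P0, mul_add, mul_sum, add_comm]
          congr 1
          · simp
          · refine sum_congr rfl fun i _ => by ring
      _ = l + ∑ i ∈ range (n + 1), ((-1) ^ (i + 1) * bb δ (a + 1) n (i + 1) *
          (l - lam δ ((i : ℝ) + 1)) * Pi (i + 1) + (-1) ^ (i + 1) * bb δ (a + 1) n i * Pi (i + 1)) := by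
          congr 1
          refine sum_congr rfl fun i hi => ?_
          rw [← bb_rec hδ ha n i (by have := mem_range.1 hi; omega)]; ring
      _ = ∑ i ∈ range (n + 1), ((-1) ^ i * bb δ (a + 1) n i * (l - lam δ i) * Pi i +
          (-1) ^ (i + 1) * bb δ (a + 1) n i * Pi (i + 1)) := by
          rw [sum_add_distrib, ← add_assoc, ← A, ← sum_add_distrib]
      _ = _ := by
          have h3 : l * ((∑ i ∈ range (n + 1), (-1) ^ i * bb δ (a + 1) n i * Pi i) * (1 - L / l)) =
            ∑ i ∈ range (n + 1), ((-1) ^ i * bb δ (a + 1) n i * Pi i) * (l - L) := by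
            rw [← sum_mul]; field_simp
          rw [h3]
          refine sum_congr rfl fun i _ => ?_
          rw [hPs]; ring

/-- the value of the alternating sum at index k -/
def RR (δ : ℝ) (m n k : ℕ) : ℝ := ∏ j ∈ range n, (1 - lam δ k / lam δ ((m : ℝ) + j + 1))

theorem RR_fac {δ : ℝ} (hδ : δ ≤ 0) (m k j : ℕ) : 1 - lam δ k / lam δ ((m : ℝ) + j + 1) =
    ((m : ℝ) - k + 1 + j) * (1 - ((m : ℝ) + k + j) * δ) /
      (((m : ℝ) + 1 + j) * (1 - ((m : ℝ) + j) * δ)) := by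
  have h := lam_pos hδ (by positivity : (0 : ℝ) ≤ (m : ℝ) + j)
  have e : lam δ ((m : ℝ) + j + 1) = ((m : ℝ) + 1 + j) * (1 - ((m : ℝ) + j) * δ) := by
    unfold lam; ring
  rw [eq_div_iff (by rw [← e]; exact h.ne'), ← e, sub_mul, div_mul_cancel₀ _ h.ne', one_mul,
    lam_sub]
  ring

theorem fall_id (x k : ℝ) (i : ℕ) : fall (x + 1) i * (x + 1 - i) = (x + 1) * fall x i := by
  have h1 : fall (x + 1) (i + 1) = fall (x + 1) i * (x + 1 - i) := by
    unfold fall; rw [prod_range_succ]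
  have h2 : fall (x + 1) (i + 1) = (x + 1) * fall x i := by
    unfold fall; rw [prod_range_succ', mul_comm]
    congr 1
    · simp
    · refine prod_congr rfl fun j _ => ?_
      push_cast; ring
  rw [← h1, h2]

theorem fall_rise (m n k : ℕ) : fall (m : ℝ) k * ∏ r ∈ range n, ((m : ℝ) + 1 + r) =
    fall ((m : ℝ) + n) k * ∏ r ∈ range n, ((m : ℝ) - k + 1 + r) := by
  induction n with
  | zero => simp
  | succ n ih =>
    rw [prod_range_succ, prod_range_succ, ← mul_assoc, ih]
    have := fall_id ((m : ℝ) + n) 0 k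
    push_cast
    rw [← add_assoc]
    linear_combination (-(∏ r ∈ range n, ((m : ℝ) - k + 1 + r))) * this

theorem RR_low {δ : ℝ} (hδ : δ ≤ 0) (m n k : ℕ) (hk : k ≤ m) : RR δ m n k =
    (m.choose k : ℝ) * k.factorial * pp δ ((m : ℝ) + k) n /
      (fall ((m : ℝ) + n) k * pp δ (m : ℝ) n) := by
  have hkm : (k : ℝ) ≤ m := by exact_mod_cast hk
  unfold RR
  simp_rw [RR_fac hδ]
  rw [prod_div_distrib, prod_mul_distrib, prod_mul_distrib]
  have hf : (m.choose k : ℝ) * k.factorial = fall (m : ℝ) k := by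
    have h1 : (m.descFactorial k : ℝ) = fall (m : ℝ) k := by
      unfold fall
      rw [Nat.descFactorial_eq_prod_range]
      push_cast
      refine prod_congr rfl fun j hj => ?_
      rw [Nat.cast_sub (by have := mem_range.1 hj; omega)]
    rw [← h1, Nat.descFactorial_eq_factorial_mul_choose]; push_cast; ring
  rw [hf]
  have h2 := fall_rise m n k
  have p0 := (pp_pos hδ (by positivity : (0 : ℝ) ≤ m) n).ne'
  have f0 : fall ((m : ℝ) + n) k ≠ 0 := fall_ne (by have : (0 : ℝ) ≤ n := by positivity
                                                    linarith)
  have q0 : ∏ r ∈ range n, ((m : ℝ) + 1 + r) ≠ 0 := prod_ne_zero_iff.2 fun r _ => by positivity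
  have e1 : ∏ j ∈ range n, (1 - ((m : ℝ) + k + j) * δ) = pp δ ((m : ℝ) + k) n := rfl
  have e2 : ∏ j ∈ range n, (1 - ((m : ℝ) + j) * δ) = pp δ (m : ℝ) n := rfl
  rw [e1, e2, div_eq_div_iff (mul_ne_zero q0 p0) (mul_ne_zero f0 p0)]
  linear_combination (-(pp δ ((m : ℝ) + k) n * pp δ (m : ℝ) n)) * h2

theorem RR_mid {δ : ℝ} (hδ : δ ≤ 0) (m n k : ℕ) (h1 : m < k) (h2 : k ≤ m + n) : RR δ m n k = 0 := by
  unfold RR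
  refine prod_eq_zero (i := k - m - 1) (by rw [mem_range]; omega) ?_
  rw [RR_fac hδ]
  have : (((k - m - 1 : ℕ)) : ℝ) = k - m - 1 := by
    rw [Nat.cast_sub (by omega), Nat.cast_sub (by omega)]; simp
  rw [this]; ring

theorem RR_high {δ : ℝ} (hδ : δ ≤ 0) (m n k : ℕ) (h1 : m + n < k) : 0 < (-1) ^ n * RR δ m n k := by
  unfold RR
  have : (-1 : ℝ) ^ n = ∏ _j ∈ range n, (-1 : ℝ) := by simp
  rw [this, ← prod_mul_distrib]
  refine prod_pos fun j hj => ?_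
  rw [RR_fac hδ, ← mul_div_assoc]
  have hj' := mem_range.1 hj
  have hk : (m : ℝ) + 1 + j + 1 ≤ k := by exact_mod_cast (by omega : m + 1 + j + 1 ≤ k)
  have d1 : ((m : ℝ) + k + j) * δ ≤ 0 := mul_nonpos_of_nonneg_of_nonpos (by positivity) hδ
  have d2 : ((m : ℝ) + j) * δ ≤ 0 := mul_nonpos_of_nonneg_of_nonpos (by positivity) hδ
  refine div_pos ?_ (mul_pos (by positivity) (by linarith))
  rw [← mul_assoc]
  exact mul_pos (by linarith) (by linarith)


namespace Pr
variable {δ β γ : ℝ} {J : Set ℝ} {f : ℝ → ℝ} {κ τ : ℝ}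

theorem poly_iff (H : Pr δ β γ J f κ τ) {g : ℝ → ℝ} (hg : L2 J f g) (hc : ContinuousOn g J)
    (N : ℕ) : (∀ k, N < k → ∫ x, g x * (phi δ β γ k κ τ).eval x * f x = 0) ↔
      IsPolyOn g J N := by
  constructor
  · intro h
    set c : ℕ → ℝ := fun k => (∫ x, g x * (phi δ β γ k κ τ).eval x * f x) / NN δ β γ f κ τ k
      with hcdef
    set p : Polynomial ℝ := ∑ k ∈ range (N + 1), Polynomial.C (c k) * phi δ β γ k κ τ with hp
    have hpe : ∀ x, p.eval x = ∑ k ∈ range (N + 1), c k * (phi δ β γ k κ τ).eval x := fun x => by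
      rw [hp, Polynomial.eval_finsetSum]; simp
    have hpdeg : p.natDegree ≤ N := by
      refine Polynomial.natDegree_sum_le_of_forall_le _ _ fun k hk => ?_
      have hk' := mem_range.1 hk
      refine (Polynomial.natDegree_C_mul_le _ _).trans ((phi_natDegree k κ τ).trans (by omega))
    refine ⟨p, hpdeg, ?_⟩
    have hpk : ∀ k, ∫ x, p.eval x * (phi δ β γ k κ τ).eval x * f x =
        ∫ x, g x * (phi δ β γ k κ τ).eval x * f x := by
      intro k
      by_cases hk : N < k
      · rw [h k hk, H.pair_low (lt_of_le_of_lt hpdeg hk)]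
      · have e : (fun x => p.eval x * (phi δ β γ k κ τ).eval x * f x) = fun x =>
            ∑ j ∈ range (N + 1), c j * ((phi δ β γ j κ τ).eval x * (phi δ β γ k κ τ).eval x * f x) := by
          funext x
          rw [hpe, sum_mul, sum_mul]
          exact sum_congr rfl fun j _ => by ring
        rw [e, integral_finsetSum _ fun j _ => (H.L2_mul_poly (H.L2_poly _) _).const_mul _]
        rw [sum_eq_single k]
        · rw [integral_const_mul]
          have e2 : ∫ x, (phi δ β γ k κ τ).eval x * (phi δ β γ k κ τ).eval x * f x =
              NN δ β γ f κ τ k := by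
            unfold NN; congr 1; funext x; ring
          rw [e2]
          exact div_mul_cancel₀ _ (H.NN_pos k).ne'
        · intro j _ hj
          rw [integral_const_mul, H.ortho hj, mul_zero]
        · intro hk'
          exact absurd (mem_range.2 (by omega)) hk'
    have hu : L2 J f (fun x => g x - p.eval x) := by
      rw [H.L2_memLp] at *
      exact hg.sub (H.L2_memLp.1 (H.L2_poly p))
    have hz := H.zero_of_ortho hu fun k => by
      have e : (fun x => (g x - p.eval x) * (phi δ β γ k κ τ).eval x * f x) = fun x =>
          g x * (phi δ β γ k κ τ).eval x * f x - p.eval x * (phi δ β γ k κ τ).eval x * f x := by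
        funext x; ring
      rw [e, integral_sub (H.L2_mul_poly hg _) (H.L2_mul_poly (H.L2_poly _) _), hpk, sub_self]
    have := Measure.eqOn_open_of_ae_eq (μ := volume) (f := g) (g := fun x => p.eval x) (U := J)
      (by filter_upwards [hz] with x hx; linarith) H.isOpen hc p.continuous.continuousOn
    exact fun x hx => this hx
  · rintro ⟨p, hp, hgp⟩ k hk
    rw [← H.pair_low (lt_of_le_of_lt hp hk)]
    congr 1; funext x
    by_cases hx : x ∈ J
    · rw [hgp x hx]
    · rw [H.zero_off hx]; simp

theorem main (H : Pr δ β γ J f 1 τ) (h1 : ∫ x, f x = 1) (m n : ℕ) (hn : 1 ≤ n)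
    (gd : ℕ → ℝ → ℝ) (hW : ∀ k < max m n, WD J (gd k) (gd (k + 1)))
    (hi : Integrable (fun x => pq δ β γ x ^ n * gd n x ^ 2 * f x))
    (hi2 : ∀ i, n < i → i ≤ m → Integrable (fun x => pq δ β γ x ^ i * gd i x * f x)) :
    L2 J f (gd 0) ∧
    (((∑ i ∈ Finset.Icc 1 m,
      ((m.choose i : ℝ) * pp δ ((m : ℝ) + i) n /
          (fall ((m : ℝ) + n) i * (∫ x, pq δ β γ x ^ i * f x) * pp δ ((i : ℝ) - 1) i *
            pp δ (m : ℝ) n)) *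
        (∫ x, pq δ β γ x ^ i * gd i x * f x) ^ 2) +
    ∑ i ∈ Finset.Icc 1 n,
      (-1 : ℝ) ^ (i - 1) *
          ((n.choose i : ℝ) / (fall ((m : ℝ) + n) i * pp δ (m : ℝ) i)) *
        ∫ x, pq δ β γ x ^ i * (gd i x) ^ 2 * f x) =
      (∫ x, gd 0 x ^ 2 * f x) - (∫ x, gd 0 x * f x) ^ 2 ↔ IsPolyOn (gd 0) J (m + n)) := by
  have hδ := H.hδ
  have hWn : ∀ r < n, WD J (gd r) (gd (r + 1)) := fun r hr => hW r (lt_of_lt_of_le hr (le_max_right _ _))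
  have hWm : ∀ r < m, WD J (gd r) (gd (r + 1)) := fun r hr => hW r (lt_of_lt_of_le hr (le_max_left _ _))
  have hm : AEStronglyMeasurable (gd n) (volume.restrict J) := by
    obtain ⟨k, rfl⟩ : ∃ k, n = k + 1 := ⟨n - 1, by omega⟩
    exact (hWn k (by omega)).aesm H.conn H.isOpen
  have low := H.L2_low n gd hWn hm hi
  have hL2 : L2 J f (gd 0) := (H.iter n gd hWn hm hi).1
  refine ⟨hL2, ?_⟩
  have hcont : ContinuousOn (gd 0) J := (hWn 0 (by omega)).contOn H.conn H.isOpen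
  set C : ℕ → ℝ := CC δ β γ f 1 τ (gd 0) with hC
  -- first sum
  have S1 : ∀ i ∈ Finset.Icc 1 m, ((m.choose i : ℝ) * pp δ ((m : ℝ) + i) n /
          (fall ((m : ℝ) + n) i * (∫ x, pq δ β γ x ^ i * f x) * pp δ ((i : ℝ) - 1) i *
            pp δ (m : ℝ) n)) *
        (∫ x, pq δ β γ x ^ i * gd i x * f x) ^ 2 = RR δ m n i * C i := by
    intro i hi'
    obtain ⟨hi1, him⟩ := Finset.mem_Icc.1 hi'
    have hIntg : Integrable (fun x => pq δ β γ x ^ i * gd i x * f x) := by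
      rcases le_or_gt i n with h | h
      · exact (low i h).2.2
      · exact hi2 i h him
    have hpair := (H.pair i gd (fun r hr => hWm r (by omega)) hIntg).2
    simp only [hC, CC]
    rw [hpair, H.NN_eq, lcf_eq, RR_low hδ m n i him]
    have e : ∏ j ∈ range i, ((1 : ℝ) - ((i : ℝ) - 1 + j) * δ) = pp δ ((i : ℝ) - 1) i := rfl
    rw [e]
    have hp1 : pp δ ((i : ℝ) - 1) i ≠ 0 := (pp_pos hδ (by
      have : (1 : ℝ) ≤ i := by exact_mod_cast hi1
      linarith) i).ne'
    have hp2 : pp δ (m : ℝ) n ≠ 0 := (pp_pos hδ (by positivity) n).ne'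
    have hq := (H.int_qpow_pos i).ne'
    have hf : fall ((m : ℝ) + n) i ≠ 0 := fall_ne (by
      have : (i : ℝ) ≤ m := by exact_mod_cast him
      have : (0 : ℝ) ≤ n := by positivity
      linarith)
    have hfac : (i.factorial : ℝ) ≠ 0 := by positivity
    field_simp
  rw [sum_congr rfl S1]
  -- second sum
  set I : ℕ → ℝ := fun i => ∫ x, pq δ β γ x ^ i * (gd i x) ^ 2 * f x with hI
  have hs : HasSum (fun k => RR δ m n k * C k)
      (∑ i ∈ range (n + 1), ((-1) ^ i * bb δ m n i) * I i) := by
    have := hasSum_sum (s := range (n + 1)) (f := fun i k => ((-1) ^ i * bb δ m n i) * (Lam δ i 1 k * C k))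
      (a := fun i => ((-1) ^ i * bb δ m n i) * I i) (fun i hi' => by
        have hin : i ≤ n := by have := mem_range.1 hi'; omega
        exact (H.iter i gd (fun r hr => hWn r (by omega)) (low i hin).1 (low i hin).2.1).2.mul_left _)
    convert this using 2 with k
    have hT := Tsum hδ (Nat.cast_nonneg m) n (lam δ k)
    unfold RR
    rw [← hT, sum_mul]
    refine sum_congr rfl fun i _ => ?_
    rw [Lam_eq]
    have : ∏ r ∈ range i, (lam δ k - lam δ r) =
        ∏ r ∈ range i, (((k : ℝ) - r) * (1 - ((k : ℝ) - 1 + r) * δ)) :=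
      prod_congr rfl fun r _ => lam_sub δ r k
    rw [this]; ring
  have hsplit : ∑ i ∈ range (n + 1), ((-1) ^ i * bb δ m n i) * I i =
      (∫ x, gd 0 x ^ 2 * f x) - ∑ i ∈ Finset.Icc 1 n,
      (-1 : ℝ) ^ (i - 1) *
          ((n.choose i : ℝ) / (fall ((m : ℝ) + n) i * pp δ (m : ℝ) i)) * I i := by
    have e : Finset.Icc 1 n = Finset.Ico 1 (n + 1) := by ext; simp
    rw [sum_range_eq_add_Ico _ (by omega), e, sub_eq_add_neg, ← sum_neg_distrib]
    congr 1
    · simp [bb, fall, pp, hI]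
    · refine sum_congr rfl fun i hi' => ?_
      obtain ⟨k, rfl⟩ : ∃ k, i = k + 1 := ⟨i - 1, by have := (Finset.mem_Ico.1 hi').1; omega⟩
      unfold bb
      simp only [Nat.add_sub_cancel, pow_succ]
      ring
  rw [hsplit] at hs
  set S2 := ∑ i ∈ Finset.Icc 1 n,
      (-1 : ℝ) ^ (i - 1) *
          ((n.choose i : ℝ) / (fall ((m : ℝ) + n) i * pp δ (m : ℝ) i)) * I i with hS2
  -- zero term
  have hR0 : RR δ m n 0 = 1 := by unfold RR; simp [lam]
  have hphi0 : phi δ β γ 0 1 τ = 1 := by simp [phi]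
  have hC0 : C 0 = (∫ x, gd 0 x * f x) ^ 2 := by
    simp only [hC, CC, NN, hphi0]
    simp [h1]
  have hfirst : ∑ k ∈ range (m + 1), RR δ m n k * C k =
      (∫ x, gd 0 x * f x) ^ 2 + ∑ i ∈ Finset.Icc 1 m, RR δ m n i * C i := by
    have e : Finset.Icc 1 m = Finset.Ico 1 (m + 1) := by ext; simp
    rw [sum_range_eq_add_Ico _ (by omega), e, hR0, hC0, one_mul]
  have htail := ((hasSum_nat_add_iff' (m + 1)).2 hs).mul_left ((-1) ^ n)
  rw [hfirst] at htail
  have hCnn : ∀ k, 0 ≤ C k := fun k => div_nonneg (sq_nonneg _) (H.NN_pos k).le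
  have hnn : ∀ k, 0 ≤ (-1) ^ n * (RR δ m n (k + (m + 1)) * C (k + (m + 1))) := by
    intro k
    rw [← mul_assoc]
    refine mul_nonneg ?_ (hCnn _)
    rcases le_or_gt (k + (m + 1)) (m + n) with h | h
    · rw [RR_mid hδ m n _ (by omega) h, mul_zero]
    · exact (RR_high hδ m n _ h).le
  have hsgn : ((-1 : ℝ)) ^ n ≠ 0 := pow_ne_zero _ (by norm_num)
  rw [← H.poly_iff hL2 hcont]
  have hCz : ∀ k, C k = 0 ↔ ∫ x, gd 0 x * (phi δ β γ k 1 τ).eval x * f x = 0 := by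
    intro k
    simp only [hC, CC]
    rw [div_eq_zero_iff, or_iff_left (H.NN_pos k).ne', sq_eq_zero_iff]
  constructor
  · intro h
    have hz : (-1 : ℝ) ^ n * (((∫ x, gd 0 x ^ 2 * f x) - S2) -
      ((∫ x, gd 0 x * f x) ^ 2 + ∑ i ∈ Finset.Icc 1 m, RR δ m n i * C i)) = 0 := by
      rw [mul_eq_zero]; right; linarith
    rw [hz, hasSum_zero_iff_of_nonneg hnn] at htail
    intro k hk
    rw [← hCz]
    have := congrFun htail (k - (m + 1))
    simp only [Pi.zero_apply] at this
    rw [show k - (m + 1) + (m + 1) = k by omega, ← mul_assoc] at this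
    exact (mul_eq_zero.1 this).resolve_left (RR_high hδ m n k hk).ne'
  · intro h
    have hz : (fun k => (-1 : ℝ) ^ n * (RR δ m n (k + (m + 1)) * C (k + (m + 1)))) = fun _ => 0 := by
      funext k
      rcases le_or_gt (k + (m + 1)) (m + n) with h' | h'
      · rw [RR_mid hδ m n _ (by omega) h', zero_mul, mul_zero]
      · rw [(hCz _).2 (h _ h'), mul_zero, mul_zero]
    rw [hz] at htail
    have := htail.unique hasSum_zero
    have := (mul_eq_zero.1 this).resolve_left hsgn
    linarith

end Pr


theorem pq_roots_finite {δ β γ : ℝ} (h : 0 < |δ| + |β| + |γ|) : {x | pq δ β γ x = 0}.Finite := by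
  have hne : Pr.qP δ β γ ≠ 0 := by
    intro h0
    have e : ∀ x, pq δ β γ x = 0 := fun x => by rw [← Pr.qP_eval, h0]; simp
    have e0 := e 0
    have e1 := e 1
    have e2 := e (-1)
    simp only [pq] at e0 e1 e2
    have hγ : γ = 0 := by linarith
    have hβ : β = 0 := by linarith
    have hd : δ = 0 := by linarith
    simp [hγ, hβ, hd] at h
  refine (Polynomial.finite_setOfPred_isRoot hne).subset fun x hx => ?_
  simp only [Set.mem_setOf_eq, Polynomial.IsRoot, Pr.qP_eval] at hx ⊢
  exact hx

theorem base_aemeas {f : ℝ → ℝ} {μ δ β γ : ℝ} (hpos : 0 < |δ| + |β| + |γ|)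
    (heq : ∀ x : ℝ, (∫ t in Set.Iic x, (μ - t) * f t) = pq δ β γ x * f x) : AEMeasurable f := by
  set A : Set ℝ := {x | IntegrableOn (fun t => (μ - t) * f t) (Set.Iic x)} with hA
  set B : Set ℝ := ⋃ r : {r : ℚ // (r : ℝ) ∈ A}, Set.Iic ((r : ℚ) : ℝ) with hB
  have hBm : MeasurableSet B := MeasurableSet.iUnion fun r => measurableSet_Iic
  have h1 : AEMeasurable f (volume.restrict B) := by
    refine AEMeasurable.iUnion fun r => ?_
    have hr : AEMeasurable (fun t => (μ - t) * f t) (volume.restrict (Set.Iic ((r : ℚ) : ℝ))) :=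
      (show IntegrableOn _ _ _ from r.2).aestronglyMeasurable.aemeasurable
    have h2 : AEMeasurable (fun t => ((μ - t) * f t) / (μ - t))
      (volume.restrict (Set.Iic ((r : ℚ) : ℝ))) :=
      hr.div (by fun_prop)
    refine h2.congr ?_
    have h3 : ∀ᵐ t ∂(volume.restrict (Set.Iic ((r : ℚ) : ℝ))), t ≠ μ :=
      ae_restrict_of_ae (Measure.ae_ne volume μ)
    filter_upwards [h3] with t ht
    have : μ - t ≠ 0 := sub_ne_zero.2 (Ne.symm ht)
    field_simp
  have h2 : AEMeasurable (B.indicator f) := (aemeasurable_indicator_iff hBm).2 h1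
  refine h2.congr ?_
  have hsub : (A \ B).Subsingleton := by
    have key : ∀ x ∈ A \ B, ∀ y ∈ A \ B, ¬ x < y := by
      intro x hx y hy hxy
      obtain ⟨r, hr1, hr2⟩ := exists_rat_btwn hxy
      apply hx.2
      refine Set.mem_iUnion.2 ⟨⟨r, ?_⟩, hr1.le⟩
      exact (show IntegrableOn _ _ _ from hy.1).mono_set (Set.Iic_subset_Iic.2 hr2.le)
    intro x hx y hy
    exact le_antisymm (not_lt.1 (key y hy x hx)) (not_lt.1 (key x hx y hy))
  have hfin : ({x | pq δ β γ x = 0} ∪ (A \ B)).Finite :=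
    (pq_roots_finite hpos).union hsub.finite
  have hae : ∀ᵐ x : ℝ, x ∉ ({x | pq δ β γ x = 0} ∪ (A \ B)) :=
    measure_eq_zero_iff_ae_notMem.1 (hfin.measure_zero volume)
  filter_upwards [hae] with x hx
  by_cases hxB : x ∈ B
  · simp [hxB]
  · simp only [hxB, not_false_eq_true, Set.indicator_of_notMem]
    have hxA : x ∉ A := fun h => hx (Or.inr ⟨h, hxB⟩)
    have h0 := heq x
    rw [integral_undef hxA] at h0
    exact ((mul_eq_zero.1 h0.symm).resolve_left fun h => hx (Or.inl h)).symm

theorem int_pos_open {u : ℝ → ℝ} {U : Set ℝ} (hu : ∀ t, 0 ≤ u t) (hi : Integrable u)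
    (ho : IsOpen U) (hne : U.Nonempty) (hU : ∀ t ∈ U, 0 < u t) : 0 < ∫ t, u t := by
  rw [integral_pos_iff_support_of_nonneg hu hi]
  exact lt_of_lt_of_le (ho.measure_pos volume hne) (measure_mono fun t ht => (hU t ht).ne')

theorem erealIoo_open (α ω : EReal) : IsOpen (erealIoo α ω) :=
  (isOpen_Ioo (a := α) (b := ω)).preimage continuous_coe_real_ereal

theorem erealIoo_conn (α ω : EReal) : (erealIoo α ω).OrdConnected := by
  refine ⟨fun x hx y hy z hz => ⟨lt_of_lt_of_le hx.1 ?_, lt_of_le_of_lt ?_ hy.2⟩⟩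
  · exact_mod_cast hz.1
  · exact_mod_cast hz.2

theorem base {P : Measure ℝ} {f : ℝ → ℝ} {μ δ β γ : ℝ} (hδ : δ ≤ 0)
    (hIP : IsIntegratedPearson P f μ δ β γ) {J : Set ℝ} (hJ : J = {x | 0 < f x})
    (ho : IsOpen J) (hc : J.OrdConnected) :
    Pr δ β γ J f 1 μ ∧ ∫ x, f x = 1 := by
  obtain ⟨hPr, hnn, hP, hIntg, hμ, hpos, heq⟩ := hIP
  have hae := base_aemeas hpos heq
  have hae' : AEMeasurable (fun x => ENNReal.ofReal (f x)) := hae.ennreal_ofReal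
  have hfin : ∀ᵐ x : ℝ, ENNReal.ofReal (f x) < ⊤ := Eventually.of_forall fun x => ENNReal.ofReal_lt_top
  have hI : ∀ u : ℝ → ℝ, Integrable u P ↔ Integrable (fun x => u x * f x) := fun u => by
    rw [hP, integrable_withDensity_iff_integrable_smul₀' hae' hfin]
    refine iff_of_eq (congrArg (fun v => Integrable v volume) (funext fun x => ?_))
    rw [ENNReal.toReal_ofReal (hnn x), smul_eq_mul, mul_comm]
  have hE : ∀ u : ℝ → ℝ, ∫ x, u x ∂P = ∫ x, u x * f x := fun u => by
    rw [hP, integral_withDensity_eq_integral_toReal_smul₀ hae' hfin]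
    congr 1; funext x
    rw [ENNReal.toReal_ofReal (hnn x), smul_eq_mul, mul_comm]
  have int0 : Integrable f := by
    have := (hI fun _ => 1).1 (integrable_const _)
    simpa using this
  have int1 : Integrable (fun x => x * f x) := (hI _).1 hIntg
  have h1 : ∫ x, f x = 1 := by
    have := hE fun _ => 1
    simp at this
    exact this.symm
  have hmean : ∫ x, x * f x = μ := by rw [hμ, hE]
  have intk : Integrable (fun t => (μ - t) * f t) := by
    have := (int0.const_mul μ).sub int1
    refine this.congr (Eventually.of_forall fun t => ?_)
    simp only [Pi.sub_apply]; ring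
  have totk : ∫ t, (μ - t) * f t = 0 := by
    have e : (fun t => (μ - t) * f t) = fun t => μ * f t - t * f t := by funext t; ring
    rw [e, integral_sub (int0.const_mul μ) int1, integral_const_mul, h1, hmean]; ring
  have eneg : (fun t => (t - μ) * f t) = fun t => -((μ - t) * f t) := by funext t; ring
  have intk' : Integrable (fun t => (t - μ) * f t) := by rw [eneg]; exact intk.neg
  have totk' : ∫ t, (t - μ) * f t = 0 := by rw [eneg, integral_neg, totk, neg_zero]
  have hoff : ∀ x, x ∉ J → f x = 0 := fun x hx => by
    rw [hJ] at hx
    exact le_antisymm (not_lt.1 hx) (hnn x)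
  have hon : ∀ x ∈ J, 0 < f x := fun x hx => by rw [hJ] at hx; exact hx
  have hne : J.Nonempty := by
    by_contra h
    rw [Set.not_nonempty_iff_eq_empty] at h
    have : f = fun _ => 0 := funext fun x => hoff x (by simp [h])
    rw [this] at h1
    simp at h1
  have hmem : μ ∈ J := mean_mem hc ho hne hJ hnn intk' totk'
  have hFpos : ∀ x ∈ J, 0 < ∫ t in Set.Iic x, (μ - t) * f t := by
    intro x hx
    obtain ⟨ε, hε, hI'⟩ := exists_Icc_nhds hc ho hx
    rcases le_or_gt x μ with hxm | hxm
    · rw [← integral_indicator measurableSet_Iic]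
      refine int_pos_open (U := J ∩ Set.Iio x) (fun t => ?_) (intk.indicator measurableSet_Iic)
        (ho.inter isOpen_Iio) ⟨x - ε, hI' ⟨le_rfl, by linarith⟩, by simp [hε]⟩ fun t ht => ?_
      · refine Set.indicator_nonneg (fun t ht => mul_nonneg ?_ (hnn t)) t
        have : t ≤ x := ht
        linarith
      · have h2 : t < x := ht.2
        rw [Set.indicator_of_mem (show t ∈ Set.Iic x from h2.le)]
        exact mul_pos (by linarith) (hon t ht.1)
    · have hsum := integral_add_compl (measurableSet_Iic (a := x)) intk
      rw [totk, Set.compl_Iic] at hsum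
      have : 0 < ∫ t in Set.Ioi x, (t - μ) * f t := by
        rw [← integral_indicator measurableSet_Ioi]
        refine int_pos_open (U := J ∩ Set.Ioi x) (fun t => ?_) (intk'.indicator measurableSet_Ioi)
          (ho.inter isOpen_Ioi) ⟨x + ε, hI' ⟨by linarith, le_rfl⟩, by simp [hε]⟩ fun t ht => ?_
        · refine Set.indicator_nonneg (fun t ht => mul_nonneg ?_ (hnn t)) t
          have : x < t := ht
          linarith
        · have h2 : x < t := ht.2
          rw [Set.indicator_of_mem (show t ∈ Set.Ioi x from h2)]
          exact mul_pos (by linarith) (hon t ht.1)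
      rw [eneg, integral_neg] at this
      linarith
  have hqpos : ∀ x ∈ J, 0 < pq δ β γ x := fun x hx => by
    have := hFpos x hx
    rw [heq] at this
    exact pos_of_mul_pos_left this (hnn x)
  have hqc : Measurable (pq δ β γ) := by unfold pq; fun_prop
  have hFm : Measurable (fun x => ∫ t in Set.Iic x, (μ - t) * f t) := by
    have hcont := intervalIntegral.continuous_primitive (fun a b => intk.intervalIntegrable (a := a) (b := b)) 0
    have e : (fun x => ∫ t in Set.Iic x, (μ - t) * f t) =
        fun x => (∫ t in Set.Iic (0 : ℝ), (μ - t) * f t) + ∫ t in (0 : ℝ)..x, (μ - t) * f t := by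
      funext x
      rw [← intervalIntegral.integral_Iic_sub_Iic intk.integrableOn intk.integrableOn]; ring
    rw [e]
    exact (continuous_const.add hcont).measurable
  have hfm : Measurable f := by
    have e : f = J.indicator (fun x => (∫ t in Set.Iic x, (μ - t) * f t) / pq δ β γ x) := by
      funext x
      by_cases hx : x ∈ J
      · rw [Set.indicator_of_mem hx, heq, mul_div_cancel_left₀ _ (hqpos x hx).ne']
      · rw [Set.indicator_of_notMem hx, hoff x hx]
    rw [e]
    exact (hFm.div hqc).indicator ho.measurableSet
  exact ⟨{ hδ := hδ, hκ := one_pos, nonneg := hnn, meas := hfm, hJ := hJ, conn := hc, isOpen := ho,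
           c_mem := by simpa using hmem, int0 := int0, int1 := int1,
           tot := by simpa using totk', eq := by simpa using heq, qpos := hqpos }, h1⟩

theorem WD_of_MemH {P : Measure ℝ} {q : ℝ → ℝ} {J : Set ℝ} (hc : J.OrdConnected) {m n : ℕ}
    {gd : ℕ → ℝ → ℝ} (hg : MemH P q J m n gd) : ∀ k < max m n, WD J (gd k) (gd (k + 1)) := by
  obtain ⟨h1, h2, h3, -, -⟩ := hg
  intro k hk
  have hl : 1 ≤ max m n := by omega
  by_cases hk1 : k + 1 = max m n
  · have h3' := h3 hl
    rw [← hk1] at h3'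
    exact h3'
  · have hk2 : k + 1 < max m n := by omega
    have hcont : ContinuousOn (gd (k + 1)) J := by
      by_cases hk3 : k + 1 = max m n - 1
      · rw [hk3]; exact h2 hl
      · exact fun x hx => (h1 (k + 1) (by omega) x hx).continuousAt.continuousWithinAt
    intro a ha b hb
    have hsub : Set.uIcc a b ⊆ J := hc.uIcc_subset ha hb
    have hii : IntervalIntegrable (gd (k + 1)) volume a b := (hcont.mono hsub).intervalIntegrable
    exact ⟨hii, (intervalIntegral.integral_eq_sub_of_hasDerivAt
      (fun x hx => h1 k hk2 x (hsub hx)) hii).symm⟩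



/-- **Theorem 2.1 (equality part).** If `X ∼ IP(μ; δ, β, γ)` with `δ ≤ 0`,
`n ≥ 1` and `g ∈ H^{m,n}(X)`, then `S_{m,n}(g) = Var g(X)` if and only if `g`
coincides on the support `(α, ω)` of `X` with a polynomial of degree at most `m+n`. -/
theorem pearson_variance_bound_equality_iff
    (P : Measure ℝ) (f : ℝ → ℝ) (μ δ β γ : ℝ) (hδ : δ ≤ 0)
    (hIP : IsIntegratedPearson P f μ δ β γ)
    (α ω : EReal) (hsupp : {x : ℝ | 0 < f x} = erealIoo α ω)
    (m n : ℕ) (hn : 1 ≤ n) (gd : ℕ → ℝ → ℝ)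
    (hg : MemH P (pq δ β γ) (erealIoo α ω) m n gd) :
    Sbound P δ (pq δ β γ) m n gd = variance (gd 0) P ↔
      IsPolyOn (gd 0) (erealIoo α ω) (m + n) := by
  have ho := erealIoo_open α ω
  have hc := erealIoo_conn α ω
  obtain ⟨H, h1⟩ := base hδ hIP hsupp.symm ho hc
  have hPn : P = Pr.nu f := hIP.2.2.1
  have hprob : IsProbabilityMeasure P := hIP.1
  have hW := WD_of_MemH hc hg
  obtain ⟨-, -, -, hi, hi2⟩ := hg
  subst hPn
  have key := H.main h1 m n hn gd hW ((H.nu_integrable _).1 hi) (fun i hni him => by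
    refine (H.nu_integrable (fun x => pq δ β γ x ^ i * gd i x)).1 ?_
    have hgm : AEStronglyMeasurable (gd i) (Pr.nu f) := by
      obtain ⟨k, rfl⟩ : ∃ k, i = k + 1 := ⟨i - 1, by omega⟩
      exact H.nu_aesm_iff.1
        ((hW k (lt_of_lt_of_le (by omega) (le_max_left m n))).aesm H.conn H.isOpen)
    have hqm : AEStronglyMeasurable (fun x => pq δ β γ x ^ i) (Pr.nu f) := by
      have : Continuous (fun x => pq δ β γ x ^ i) := by unfold pq; fun_prop
      exact this.aestronglyMeasurable
    refine (hi2 i hni him).mono (hqm.mul hgm) (Eventually.of_forall fun x => ?_)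
    simp [abs_mul])
  rw [← key.2, variance_eq_sub (H.L2_memLp.1 key.1)]
  unfold Sbound
  simp only [H.nu_int, Pi.pow_apply]

end
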